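/- arXiv:2407.20953 — 2 statements merged into one kernel-verified Lean document; each statement's English description precedes it below -/
import Mathlib

section
/- Monotonicity of t_j (claim in 3.2): Let D ≥ 4 be even, j ∈ {1, …, D+1}. Let B₁, B'₁ ∈ φ(V_{D−2}) with B₁ < B'₁ (in the order ≤ on φ(V_{D−2})), and let B, B'' ∈ φ(V_D) satisfy ⟨B⟩ = τ_j(⟨B₁⟩) + F₂·e_j and ⟨B''⟩ = τ_j(⟨B'₁⟩) + F₂·e_j. Then B < B'' in φ(V_D). -/
open scoped BigOperators

/-- `W D` : functions `Z/(D+1) → F₂`. -/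
abbrev Wsp (D : ℕ) : Type := ZMod (D + 1) → ZMod 2

/-- The all-ones function. -/
def allOnes (D : ℕ) : Wsp D := fun _ => 1

/-- `V D = W/span{u}`. -/
abbrev Vsp (D : ℕ) : Type := Wsp D ⧸ Submodule.span (ZMod 2) {allOnes D}

/-- `e i` : image of the standard basis function at `i`. -/
def eV (D : ℕ) (i : ZMod (D + 1)) : Vsp D :=
  Submodule.Quotient.mk (Pi.single i 1)

/-- `e_I = ∑_{s ∈ I} e_s`. -/
def eSet (D : ℕ) (I : Finset (ZMod (D + 1))) : Vsp D := ∑ s ∈ I, eV D s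

/-- A cyclic interval (arc): nonempty proper subset of the form `{i, i+1, …, j}`. -/
def IsInterval (D : ℕ) (I : Finset (ZMod (D + 1))) : Prop :=
  ∃ (i : ZMod (D + 1)) (l : ℕ), 1 ≤ l ∧ l ≤ D ∧
    I = (Finset.range l).image (fun t : ℕ => i + (t : ZMod (D + 1)))

/-- Member of `ℐ¹` : interval of odd cardinality. -/
def OddInterval (D : ℕ) (I : Finset (ZMod (D + 1))) : Prop :=
  IsInterval D I ∧ Odd I.card

/-- `I ≺ I'` : `I ⊊ I'` and `I' − I` is a disjoint union of two intervals. -/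
def Prec (D : ℕ) (I I' : Finset (ZMod (D + 1))) : Prop :=
  I ⊂ I' ∧ ∃ I₁ I₂, IsInterval D I₁ ∧ IsInterval D I₂ ∧ Disjoint I₁ I₂ ∧ I' \ I = I₁ ∪ I₂

/-- `I ♠ I'` : `I ∩ I' = ∅` and `I ∪ I'` is not an interval. -/
def Spade (D : ℕ) (I I' : Finset (ZMod (D + 1))) : Prop :=
  I ∩ I' = ∅ ∧ ¬ IsInterval D (I ∪ I')

/-- `I^ev`. -/
noncomputable def evSet (D : ℕ) (I : Finset (ZMod (D + 1))) : Finset (ZMod (D + 1)) :=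
  @Finset.filter _
    (fun i => ∃ I' I'', OddInterval D I' ∧ OddInterval D I'' ∧ Spade D I' I'' ∧
      I.erase i = I' ∪ I'')
    (Classical.decPred _) I

/-- `B ∈ φ(V_D)` : a finite set of elements of `ℐ¹` satisfying (P0) and (P1). -/
def phi (D : ℕ) (B : Finset (Finset (ZMod (D + 1)))) : Prop :=
  (∀ I ∈ B, OddInterval D I) ∧
  (∀ I ∈ B, ∀ I' ∈ B, I = I' ∨ Spade D I I' ∨ Prec D I I' ∨ Prec D I' I) ∧
  (∀ I ∈ B, ∃ 𝒥 : Finset (Finset (ZMod (D + 1))), 𝒥 ⊆ B ∧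
    (∀ J ∈ 𝒥, Prec D J I) ∧
    (∀ J ∈ 𝒥, ∀ J' ∈ 𝒥, J ≠ J' → Disjoint J J') ∧
    evSet D I ⊆ 𝒥.biUnion id)

/-- `⟨B⟩` : the F₂-span of `{e_I : I ∈ B}`. -/
def spanB (D : ℕ) (B : Finset (Finset (ZMod (D + 1)))) : Submodule (ZMod 2) (Vsp D) :=
  Submodule.span (ZMod 2) (eSet D '' ↑B)

/-- `g_i(B) = |{I ∈ B : i ∈ I}|`. -/
def gB (D : ℕ) (B : Finset (Finset (ZMod (D + 1)))) (i : ZMod (D + 1)) : ℕ :=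
  (B.filter (fun I => i ∈ I)).card

/-- `ε(B) = ∑_i (g_i(B)(g_i(B)+1)/2 mod 2) e_i`. -/
def epsB (D : ℕ) (B : Finset (Finset (ZMod (D + 1)))) : Vsp D :=
  ∑ i : ZMod (D + 1), ((gB D B i * (gB D B i + 1) / 2 : ℕ) : ZMod 2) • eV D i

/-- The partial order `B' ≤ B` on `φ(V_D)`. -/
def leφ (D : ℕ) (B' B : Finset (Finset (ZMod (D + 1)))) : Prop :=
  ∃ (k : ℕ) (c : ℕ → Finset (Finset (ZMod (D + 1)))),
    c 0 = B' ∧ c k = B ∧ (∀ s ≤ k, phi D (c s)) ∧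
    ∀ s < k, epsB D (c s) ∈ spanB D (c (s + 1))

/-- `B' < B`. -/
def ltφ (D : ℕ) (B' B : Finset (Finset (ZMod (D + 1)))) : Prop :=
  leφ D B' B ∧ B' ≠ B

/-- `1_E ∈ ℂ[V_D]`, the indicator function of `E ⊆ V_D`. -/
noncomputable def ind (D : ℕ) (E : Set (Vsp D)) : Vsp D → ℂ := E.indicator 1

/-- `δ_x ∈ ℂ[V_D]`. -/
noncomputable def delta (D : ℕ) (x : Vsp D) : Vsp D → ℂ := ind D {x}

/-- The symplectic form on `W`. -/
def formW (D : ℕ) (x y : Wsp D) : ZMod 2 :=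
  ∑ i : ZMod (D + 1), (x i * y (i + 1) + x (i + 1) * y i)

/-- The induced symplectic form on `V_D` (well defined since the form kills `u`). -/
noncomputable def formV (D : ℕ) (x y : Vsp D) : ZMod 2 :=
  formW D (Quotient.out x) (Quotient.out y)

/-- The Fourier transform `ℂ[V_D] → ℂ[V_D]`. -/
noncomputable def fourierV (D : ℕ) (f : Vsp D → ℂ) : Vsp D → ℂ :=
  fun y => (2 : ℂ) ^ (-((D / 2 : ℕ) : ℤ)) *
    ∑ᶠ x : Vsp D, (if formV D x y = 0 then (1 : ℂ) else -1) * f x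

/-- The target in `V_D` of the basis vector `e'_ℓ` of `V_{D-2}` under `τ_j`. -/
noncomputable def tauTgt (D j : ℕ) (ℓ : ZMod (D - 2 + 1)) : Vsp D :=
  let L : ℕ := if ℓ.val = 0 then D - 1 else ℓ.val
  if ℓ = ((j - 1 : ℕ) : ZMod (D - 2 + 1)) then
    eV D ((j : ZMod (D + 1)) - 1) + eV D (j : ZMod (D + 1)) + eV D ((j : ZMod (D + 1)) + 1)
  else if L < j - 1 then eV D (L : ZMod (D + 1))
  else eV D ((L + 2 : ℕ) : ZMod (D + 1))

/-- The linear embedding `τ_j : V_{D-2} → V_D` (well defined independently of the chosen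
representative since the targets sum to `0`). -/
noncomputable def tauMap (D j : ℕ) (x : Vsp (D - 2)) : Vsp D :=
  ∑ i : ZMod (D - 2 + 1), (Quotient.out x) i • tauTgt D j i

/-! ### Cyclic arcs -/

/-- The arc of length `l` starting at `a`. -/
def arc (D : ℕ) (a : ZMod (D + 1)) (l : ℕ) : Finset (ZMod (D + 1)) :=
  (Finset.range l).image (fun t : ℕ => a + (t : ZMod (D + 1)))

theorem mem_arc {D l : ℕ} (hl : l ≤ D + 1) (a x : ZMod (D + 1)) :
    x ∈ arc D a l ↔ (x - a).val < l := by
  unfold arc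
  simp only [Finset.mem_image, Finset.mem_range]
  constructor
  · rintro ⟨t, ht, rfl⟩
    rw [add_sub_cancel_left, ZMod.val_natCast, Nat.mod_eq_of_lt (by omega)]
    exact ht
  · intro h
    refine ⟨_, h, ?_⟩
    rw [ZMod.natCast_zmod_val]
    ring

theorem add_natCast_mem_arc {D l t : ℕ} (hl : l ≤ D + 1) (ht : t ≤ D) (a : ZMod (D + 1)) :
    a + (t : ZMod (D + 1)) ∈ arc D a l ↔ t < l := by
  rw [mem_arc hl, add_sub_cancel_left, ZMod.val_natCast, Nat.mod_eq_of_lt (by omega)]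

theorem card_arc {D l : ℕ} (hl : l ≤ D + 1) (a : ZMod (D + 1)) : (arc D a l).card = l := by
  unfold arc
  rw [Finset.card_image_of_injOn, Finset.card_range]
  intro s hs t ht h
  simp only [Finset.coe_range, Set.mem_Iio] at hs ht
  have h' := congrArg ZMod.val (add_left_cancel h)
  rwa [ZMod.val_natCast, ZMod.val_natCast, Nat.mod_eq_of_lt (by omega),
    Nat.mod_eq_of_lt (by omega)] at h'

theorem exists_eq_add_natCast {D : ℕ} (a x : ZMod (D + 1)) :
    ∃ t : ℕ, t ≤ D ∧ x = a + (t : ZMod (D + 1)) := by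
  refine ⟨(x - a).val, Nat.lt_succ_iff.mp (ZMod.val_lt _), ?_⟩
  rw [ZMod.natCast_zmod_val]
  ring

theorem natCast_eq_neg_one (D : ℕ) : (D : ZMod (D + 1)) = -1 := by
  rw [eq_neg_iff_add_eq_zero]
  exact_mod_cast ZMod.natCast_self (D + 1)

theorem sub_one_eq_add_natCast {D : ℕ} (a : ZMod (D + 1)) : a - 1 = a + (D : ZMod (D + 1)) := by
  rw [natCast_eq_neg_one]; ring

theorem natCast_inj_of_le {D s t : ℕ} (hs : s ≤ D) (ht : t ≤ D)
    (h : (s : ZMod (D + 1)) = (t : ZMod (D + 1))) : s = t := by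
  have h' := congrArg ZMod.val h
  rwa [ZMod.val_natCast, ZMod.val_natCast, Nat.mod_eq_of_lt (by omega),
    Nat.mod_eq_of_lt (by omega)] at h'

theorem add_natCast_succ_sub_one {D : ℕ} (a : ZMod (D + 1)) (t : ℕ) :
    a + ((t + 1 : ℕ) : ZMod (D + 1)) - 1 = a + (t : ZMod (D + 1)) := by
  push_cast; ring

theorem arc_start_iff {D l : ℕ} (h1 : 1 ≤ l) (hl : l ≤ D) (a p : ZMod (D + 1)) :
    (p ∈ arc D a l ∧ p - 1 ∉ arc D a l) ↔ p = a := by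
  obtain ⟨t, ht, rfl⟩ := exists_eq_add_natCast a p
  rcases t with _ | t
  · have h0 := add_natCast_mem_arc (l := l) (by omega) (Nat.zero_le D) a
    have hD := add_natCast_mem_arc (l := l) (by omega) le_rfl a
    rw [← sub_one_eq_add_natCast] at hD
    simp only [Nat.cast_zero, add_zero] at h0 ⊢
    simp only [h0, hD, iff_true]
    omega
  · rw [add_natCast_succ_sub_one, add_natCast_mem_arc (by omega) ht,
      add_natCast_mem_arc (by omega) (by omega)]
    constructor
    · omega
    · intro h
      have := natCast_inj_of_le ht (Nat.zero_le D) (by simpa using h)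
      omega

theorem arc_end_iff {D l : ℕ} (h1 : 1 ≤ l) (hl : l ≤ D) (a p : ZMod (D + 1)) :
    (p ∉ arc D a l ∧ p - 1 ∈ arc D a l) ↔ p = a + (l : ZMod (D + 1)) := by
  obtain ⟨t, ht, rfl⟩ := exists_eq_add_natCast a p
  have key : a + (t : ZMod (D + 1)) = a + (l : ZMod (D + 1)) ↔ t = l :=
    ⟨fun h => natCast_inj_of_le ht hl (add_left_cancel h), fun h => by rw [h]⟩
  rw [key]
  rcases t with _ | t
  · have h0 := add_natCast_mem_arc (l := l) (by omega) (Nat.zero_le D) a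
    simp only [h0]
    omega
  · rw [add_natCast_succ_sub_one, add_natCast_mem_arc (by omega) ht,
      add_natCast_mem_arc (by omega) (by omega)]
    omega

/-- A nonempty proper subset of the circle has a starting point. -/
theorem exists_start {D : ℕ} {S : Finset (ZMod (D + 1))} {x y : ZMod (D + 1)} (hx : x ∈ S)
    (hy : y ∉ S) : ∃ p, p ∈ S ∧ p - 1 ∉ S := by
  by_contra! h
  obtain ⟨t, -, rfl⟩ := exists_eq_add_natCast y x
  induction t with
  | zero => simp [hy] at hx
  | succ t ih => exact ih (by rw [← add_natCast_succ_sub_one]; exact h _ hx)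

/-- Intervals are exactly the subsets of the circle with a single starting point. -/
theorem isInterval_iff {D : ℕ} (I : Finset (ZMod (D + 1))) :
    IsInterval D I ↔ ∃! p, p ∈ I ∧ p - 1 ∉ I := by
  constructor
  · rintro ⟨a, l, h1, hl, rfl⟩
    exact ⟨a, (arc_start_iff h1 hl a a).2 rfl, fun p hp => (arc_start_iff h1 hl a p).1 hp⟩
  · rintro ⟨p, ⟨hp, hp1⟩, huniq⟩
    have hex : ∃ l : ℕ, p + (l : ZMod (D + 1)) ∉ I := ⟨D, by rwa [← sub_one_eq_add_natCast]⟩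
    classical
    have hlD : Nat.find hex ≤ D := Nat.find_min' hex (by rwa [← sub_one_eq_add_natCast])
    have hl1 : 1 ≤ Nat.find hex := by
      rw [Nat.one_le_iff_ne_zero]
      intro h0
      have := Nat.find_spec hex
      rw [h0] at this
      simp [hp] at this
    have hout : ∀ t, Nat.find hex ≤ t → t ≤ D → p + (t : ZMod (D + 1)) ∉ I := by
      intro t ht
      induction t, ht using Nat.le_induction with
      | base => exact fun _ => Nat.find_spec hex
      | succ t ht ih =>
        intro htD hmem
        have h0 := huniq _ ⟨hmem, by rw [add_natCast_succ_sub_one]; exact ih (by omega)⟩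
        have := natCast_inj_of_le htD (Nat.zero_le D) (by simpa using h0)
        omega
    refine ⟨p, Nat.find hex, hl1, hlD, ?_⟩
    change I = arc D p (Nat.find hex)
    ext x
    obtain ⟨t, ht, rfl⟩ := exists_eq_add_natCast p x
    rw [add_natCast_mem_arc (by omega) ht]
    constructor
    · intro h
      by_contra h'
      exact hout t (by omega) ht h
    · intro h
      exact not_not.1 (Nat.find_min hex h)

theorem OddInterval.exists_arc {D : ℕ} {I : Finset (ZMod (D + 1))} (h : OddInterval D I) :
    ∃ a l, 1 ≤ l ∧ l ≤ D ∧ Odd l ∧ I = arc D a l := by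
  obtain ⟨⟨a, l, h1, hl, rfl⟩, ho⟩ := h
  refine ⟨a, l, h1, hl, ?_, rfl⟩
  rwa [← card_arc (show l ≤ D + 1 by omega) a]

theorem isInterval_arc {D l : ℕ} (h1 : 1 ≤ l) (hl : l ≤ D) (a : ZMod (D + 1)) :
    IsInterval D (arc D a l) := ⟨a, l, h1, hl, rfl⟩

theorem oddInterval_arc {D l : ℕ} (hl : l ≤ D) (ho : Odd l) (a : ZMod (D + 1)) :
    OddInterval D (arc D a l) :=
  ⟨isInterval_arc ho.pos hl a, by rwa [card_arc (by omega)]⟩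

/-- Two disjoint adjacent intervals which do not fill the circle form an interval. -/
theorem IsInterval.union_of_adjacent {D : ℕ} {I J : Finset (ZMod (D + 1))}
    (hI : IsInterval D I) (hJ : IsInterval D J) (hd : I ∩ J = ∅) {x y : ZMod (D + 1)}
    (hx : x - 1 ∈ I) (hxJ : x ∈ J) (hy : y ∉ I ∪ J) : IsInterval D (I ∪ J) := by
  rw [isInterval_iff] at hI hJ ⊢
  obtain ⟨a, -, ha⟩ := hI
  obtain ⟨b, -, hb⟩ := hJ
  have hxb : x = b := hb x ⟨hxJ, fun h => by
    have := Finset.mem_inter.2 ⟨hx, h⟩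
    simp [hd] at this⟩
  have key : ∀ p, p ∈ I ∪ J ∧ p - 1 ∉ I ∪ J → p = a := by
    rintro p ⟨hp, hp1⟩
    rw [Finset.mem_union, not_or] at hp1
    rcases Finset.mem_union.1 hp with h | h
    · exact ha p ⟨h, hp1.1⟩
    · have := hb p ⟨h, hp1.2⟩
      rw [this, ← hxb] at hp1
      exact absurd hx hp1.1
  obtain ⟨p, hp⟩ := exists_start (Finset.mem_union_right I hxJ) hy
  have hpa := key p hp
  subst hpa
  exact ⟨p, hp, key⟩

theorem Spade.symm {D : ℕ} {I J : Finset (ZMod (D + 1))} (h : Spade D I J) : Spade D J I := by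
  unfold Spade at *
  rwa [Finset.inter_comm, Finset.union_comm]

theorem exists_notMem_union_of_odd {D : ℕ} (hD : Even D) {I J : Finset (ZMod (D + 1))}
    (hI : Odd I.card) (hJ : Odd J.card) (hd : I ∩ J = ∅) : ∃ y, y ∉ I ∪ J := by
  by_contra! h
  have hu : I ∪ J = Finset.univ := Finset.eq_univ_iff_forall.2 h
  have hc := Finset.card_union_add_card_inter I J
  rw [hu, hd, Finset.card_univ, ZMod.card, Finset.card_empty] at hc
  have := hI.add_odd hJ
  rw [← hc] at this
  exact Nat.not_even_iff_odd.2 hD.add_one (by simpa using this)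

theorem Spade.not_adjacent {D : ℕ} (hD : Even D) {I J : Finset (ZMod (D + 1))}
    (hI : OddInterval D I) (hJ : OddInterval D J) (h : Spade D I J) {x : ZMod (D + 1)}
    (hx : x - 1 ∈ I) : x ∉ J := by
  intro hxJ
  obtain ⟨y, hy⟩ := exists_notMem_union_of_odd hD hI.2 hJ.2 h.1
  exact h.2 (hI.1.union_of_adjacent hJ.1 h.1 hx hxJ hy)

/-! ### The even positions of an interval -/

theorem mem_evSet {D : ℕ} {I : Finset (ZMod (D + 1))} {i : ZMod (D + 1)} :
    i ∈ evSet D I ↔ i ∈ I ∧ ∃ I' I'', OddInterval D I' ∧ OddInterval D I'' ∧ Spade D I' I'' ∧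
      I.erase i = I' ∪ I'' :=
  @Finset.mem_filter _ _ (Classical.decPred _) _ _

theorem arc_erase {D l t : ℕ} (hl : l ≤ D) (ht : t < l) (a : ZMod (D + 1)) :
    (arc D a l).erase (a + (t : ZMod (D + 1))) =
      arc D a t ∪ arc D (a + ((t + 1 : ℕ) : ZMod (D + 1))) (l - t - 1) := by
  ext x
  obtain ⟨s, hs, rfl⟩ := exists_eq_add_natCast a x
  have h1 : a + (s : ZMod (D + 1)) = a + (t : ZMod (D + 1)) ↔ s = t :=
    ⟨fun h => natCast_inj_of_le hs (by omega) (add_left_cancel h), fun h => by rw [h]⟩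
  rw [Finset.mem_erase, Finset.mem_union, add_natCast_mem_arc (by omega) hs,
    add_natCast_mem_arc (by omega) hs, ne_eq, h1]
  rcases le_or_gt (t + 1) s with h | h
  · obtain ⟨r, rfl⟩ := Nat.exists_eq_add_of_le h
    have : a + ((t + 1 + r : ℕ) : ZMod (D + 1)) =
        a + ((t + 1 : ℕ) : ZMod (D + 1)) + (r : ZMod (D + 1)) := by push_cast; ring
    rw [this, add_natCast_mem_arc (by omega) (by omega)]
    omega
  · have : a + (s : ZMod (D + 1)) = a + ((t + 1 : ℕ) : ZMod (D + 1)) +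
        ((D - (t - s) : ℕ) : ZMod (D + 1)) := by
      rw [Nat.cast_sub (by omega), natCast_eq_neg_one, Nat.cast_sub (by omega)]
      push_cast; ring
    rw [this, add_natCast_mem_arc (by omega) (by omega)]
    omega

theorem disjoint_arc_arc {D l t : ℕ} (hl : l ≤ D) (ht : t < l) (a : ZMod (D + 1)) :
    Disjoint (arc D a t) (arc D (a + ((t + 1 : ℕ) : ZMod (D + 1))) (l - t - 1)) := by
  have h := Finset.card_union_add_card_inter (arc D a t)
    (arc D (a + ((t + 1 : ℕ) : ZMod (D + 1))) (l - t - 1))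
  have hmem : a + (t : ZMod (D + 1)) ∈ arc D a l :=
    (add_natCast_mem_arc (by omega) (by omega) a).2 ht
  rw [← arc_erase hl ht, Finset.card_erase_of_mem hmem, card_arc (by omega), card_arc (by omega),
    card_arc (by omega)] at h
  rw [Finset.disjoint_iff_inter_eq_empty, ← Finset.card_eq_zero]
  omega

theorem mem_evSet_arc_of_odd {D l t : ℕ} (hl : l ≤ D) (ho : Odd l) (ht : t < l) (hto : Odd t)
    (a : ZMod (D + 1)) : a + (t : ZMod (D + 1)) ∈ evSet D (arc D a l) := by
  have hmem : a + (t : ZMod (D + 1)) ∈ arc D a l :=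
    (add_natCast_mem_arc (by omega) (by omega) a).2 ht
  obtain ⟨u, hu⟩ := hto
  obtain ⟨v, hv⟩ := ho
  rw [mem_evSet]
  refine ⟨hmem, arc D a t, arc D (a + ((t + 1 : ℕ) : ZMod (D + 1))) (l - t - 1),
    oddInterval_arc (by omega) ⟨u, hu⟩ a,
    oddInterval_arc (by omega) ⟨v - u - 1, by omega⟩ _,
    ⟨Finset.disjoint_iff_inter_eq_empty.1 (disjoint_arc_arc hl ht a), ?_⟩, arc_erase hl ht a⟩
  rw [← arc_erase hl ht, isInterval_iff]
  intro h
  have hne : ∀ s, s ≤ D → s ≠ t → a + (s : ZMod (D + 1)) ≠ a + (t : ZMod (D + 1)) :=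
    fun s hs hst h => hst (natCast_inj_of_le hs (by omega) (add_left_cancel h))
  have h0 : a + ((0 : ℕ) : ZMod (D + 1)) = a + ((t + 1 : ℕ) : ZMod (D + 1)) := by
    refine h.unique ⟨?_, ?_⟩ ⟨?_, ?_⟩
    · exact Finset.mem_erase.2 ⟨hne _ (by omega) (by omega),
        (add_natCast_mem_arc (by omega) (by omega) a).2 (by omega)⟩
    · intro h
      rw [Nat.cast_zero, add_zero, sub_one_eq_add_natCast] at h
      have := (add_natCast_mem_arc (by omega) (by omega) a).1 (Finset.mem_erase.1 h).2
      omega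
    · exact Finset.mem_erase.2 ⟨hne _ (by omega) (by omega),
        (add_natCast_mem_arc (by omega) (by omega) a).2 (by omega)⟩
    · rw [add_natCast_succ_sub_one]
      simp
  have := natCast_inj_of_le (Nat.zero_le D) (by omega) (add_left_cancel h0)
  omega

theorem odd_of_mem_evSet_arc {D l t : ℕ} (hl : l ≤ D) (ht : t < l)
    (a : ZMod (D + 1)) (h : a + (t : ZMod (D + 1)) ∈ evSet D (arc D a l)) : Odd t := by
  rw [mem_evSet] at h
  obtain ⟨-, I, J, hI, hJ, hs, he⟩ := h
  have hnm : a + (t : ZMod (D + 1)) ∉ I ∪ J := by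
    rw [← he]; simp
  have hmem : ∀ s, s ≤ D → (a + (s : ZMod (D + 1)) ∈ I ∪ J ↔ s < l ∧ s ≠ t) := by
    intro s hs
    rw [← he, Finset.mem_erase, add_natCast_mem_arc (by omega) hs, and_comm, ne_eq, add_right_inj]
    exact and_congr_right fun _ => not_congr
      ⟨fun h => natCast_inj_of_le hs (by omega) h, fun h => by rw [h]⟩
  have noadj : ∀ I J : Finset (ZMod (D + 1)), IsInterval D I → IsInterval D J → Spade D I J →
      a + (t : ZMod (D + 1)) ∉ I ∪ J → ∀ x, x - 1 ∈ I → x ∉ J :=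
    fun I J hI hJ hs hy x hx hxJ => hs.2 (hI.union_of_adjacent hJ hs.1 hx hxJ hy)
  have step : ∀ I J : Finset (ZMod (D + 1)), IsInterval D I → IsInterval D J → Spade D I J →
      a + (t : ZMod (D + 1)) ∉ I ∪ J →
      (∀ s, s ≤ D → (a + (s : ZMod (D + 1)) ∈ I ∪ J ↔ s < l ∧ s ≠ t)) →
      ∀ r s, r ≤ s → s < l → (s < t ∨ t < r) → a + (r : ZMod (D + 1)) ∈ I →
        a + (s : ZMod (D + 1)) ∈ I := by
    intro I J hI hJ hs hy hm r s hrs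
    induction s, hrs using Nat.le_induction with
    | base => exact fun _ _ h => h
    | succ s hrs ih =>
      intro h1 h2 h3
      have h4 := ih (by omega) (by omega) h3
      have h5 := (hm (s + 1) (by omega)).2 ⟨h1, by omega⟩
      rcases Finset.mem_union.1 h5 with h6 | h6
      · exact h6
      · rw [← add_natCast_succ_sub_one] at h4
        exact absurd h6 (noadj I J hI hJ hs hy _ h4)
  have main : ∀ I J : Finset (ZMod (D + 1)), IsInterval D I → IsInterval D J → Spade D I J →
      Odd I.card → (∀ s, s ≤ D → (a + (s : ZMod (D + 1)) ∈ I ∪ J ↔ s < l ∧ s ≠ t)) →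
      0 < t → a + ((0 : ℕ) : ZMod (D + 1)) ∈ I → Odd t := by
    intro I J hI hJ hs ho hm ht0 h0
    have hy : a + (t : ZMod (D + 1)) ∉ I ∪ J := by
      rw [hm t (by omega)]; simp
    have hlow : ∀ s, s < t → a + (s : ZMod (D + 1)) ∈ I := fun s hst =>
      step I J hI hJ hs hy hm 0 s (by omega) (by omega) (Or.inl hst) h0
    obtain ⟨b, ⟨hb, -⟩, -⟩ := (isInterval_iff J).1 hJ
    obtain ⟨q, hq, rfl⟩ := exists_eq_add_natCast a b
    have hdis : ∀ x, x ∈ I → x ∉ J := fun x h1 h2 => by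
      have := Finset.mem_inter.2 ⟨h1, h2⟩
      simp [hs.1] at this
    have hq1 := (hm q hq).1 (Finset.mem_union_right _ hb)
    have hqt : t < q := by
      by_contra hc
      exact hdis _ (hlow q (by omega)) hb
    have hIeq : I = arc D a t := by
      ext x
      obtain ⟨s, hsD, rfl⟩ := exists_eq_add_natCast a x
      rw [add_natCast_mem_arc (by omega) hsD]
      refine ⟨fun hx => ?_, hlow s⟩
      by_contra hst
      have hs1 := (hm s hsD).1 (Finset.mem_union_left _ hx)
      rcases le_total s q with h | h
      · exact hdis _ (step I J hI hJ hs hy hm s q h hq1.1 (Or.inr (by omega)) hx) hb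
      · refine hdis _ hx (step J I hJ hI hs.symm ?_ ?_ q s h hs1.1 (Or.inr hqt) hb)
        · rwa [Finset.union_comm]
        · rwa [Finset.union_comm]
    rwa [hIeq, card_arc (by omega)] at ho
  rcases Nat.eq_zero_or_pos t with rfl | ht0
  · exfalso
    apply hs.2
    obtain ⟨b, ⟨hb, -⟩, -⟩ := (isInterval_iff J).1 hJ.1
    obtain ⟨q, hq, rfl⟩ := exists_eq_add_natCast a b
    have := (hmem q hq).1 (Finset.mem_union_right _ hb)
    have h0 : arc D a 0 = ∅ := by simp [arc]
    rw [← he, arc_erase hl ht, h0, Finset.empty_union]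
    exact isInterval_arc (by omega) (by omega) _
  · rcases Finset.mem_union.1 ((hmem 0 (by omega)).2 ⟨by omega, by omega⟩) with h0 | h0
    · exact main I J hI.1 hJ.1 hs hI.2 hmem ht0 h0
    · exact main J I hJ.1 hI.1 hs.symm hJ.2 (by rwa [Finset.union_comm]) ht0 h0

theorem mem_evSet_iff_pred {D : ℕ} {I : Finset (ZMod (D + 1))} (hI : OddInterval D I)
    {i : ZMod (D + 1)} (hi : i ∈ I) : i ∈ evSet D I ↔ i - 1 ∈ I ∧ i - 1 ∉ evSet D I := by
  obtain ⟨a, l, h1, hl, ho, rfl⟩ := hI.exists_arc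
  have key : ∀ t, t < l → (a + (t : ZMod (D + 1)) ∈ evSet D (arc D a l) ↔ Odd t) := fun t ht =>
    ⟨odd_of_mem_evSet_arc hl ht a, fun h => mem_evSet_arc_of_odd hl ho ht h a⟩
  obtain ⟨t, ht, rfl⟩ := exists_eq_add_natCast a i
  rw [add_natCast_mem_arc (by omega) ht] at hi
  rw [key t hi]
  rcases t with _ | t
  · rw [Nat.cast_zero, add_zero, sub_one_eq_add_natCast, add_natCast_mem_arc (by omega) le_rfl]
    have : ¬ Odd 0 := by decide
    simp only [this, false_iff, not_and]
    omega
  · rw [add_natCast_succ_sub_one, add_natCast_mem_arc (by omega) (by omega), key t (by omega),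
      Nat.odd_add_one]
    exact ⟨fun h => ⟨by omega, h⟩, fun h => h.2⟩

theorem OddInterval.induction_on {D : ℕ} {I : Finset (ZMod (D + 1))} (hI : OddInterval D I)
    {P : ZMod (D + 1) → Prop} (start : ∀ i ∈ I, i - 1 ∉ I → P i)
    (step : ∀ i ∈ I, i - 1 ∈ I → P (i - 1) → P i) : ∀ i ∈ I, P i := by
  obtain ⟨a, l, h1, hl, ho, rfl⟩ := hI.exists_arc
  intro i hi
  obtain ⟨t, ht, rfl⟩ := exists_eq_add_natCast a i
  rw [add_natCast_mem_arc (by omega) ht] at hi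
  induction t with
  | zero =>
    have := (arc_start_iff h1 hl a a).2 rfl
    simpa using start a this.1 this.2
  | succ t ih =>
    refine step _ ((add_natCast_mem_arc (by omega) ht a).2 hi) ?_ ?_
    · rw [add_natCast_succ_sub_one]
      exact (add_natCast_mem_arc (by omega) (by omega) a).2 (by omega)
    · rw [add_natCast_succ_sub_one]
      exact ih (by omega) (by omega)

theorem mem_of_mem_evSet {D : ℕ} {I : Finset (ZMod (D + 1))} {i : ZMod (D + 1)}
    (h : i ∈ evSet D I) : i ∈ I := (mem_evSet.1 h).1

/-- Removing an inner point from an interval. -/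
theorem IsInterval.singleton_prec {D : ℕ} {I : Finset (ZMod (D + 1))} (hI : IsInterval D I)
    {i : ZMod (D + 1)} (hi : i ∈ I) (hp : i - 1 ∈ I) (hn : i + 1 ∈ I) : Prec D {i} I := by
  obtain ⟨a, l, h1, hl, rfl⟩ := hI
  change i ∈ arc D a l at hi
  change i - 1 ∈ arc D a l at hp
  change i + 1 ∈ arc D a l at hn
  change Prec D {i} (arc D a l)
  have hsub : {i} ⊆ arc D a l := Finset.singleton_subset_iff.2 hi
  obtain ⟨t, ht, rfl⟩ := exists_eq_add_natCast a i
  have hi' := (add_natCast_mem_arc (by omega) ht a).1 hi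
  have ht0 : t ≠ 0 := by
    rintro rfl
    rw [Nat.cast_zero, add_zero, sub_one_eq_add_natCast, add_natCast_mem_arc (by omega) le_rfl] at hp
    omega
  have htl : t + 1 < l := by
    rw [← add_natCast_mem_arc (by omega) (by omega) a]
    rwa [Nat.cast_add, Nat.cast_one, ← add_assoc]
  refine ⟨⟨hsub, fun h => ?_⟩, arc D a t, _, isInterval_arc (by omega) (by omega) _,
    isInterval_arc (l := l - t - 1) (by omega) (by omega) _, disjoint_arc_arc hl hi' a, ?_⟩
  · have := Finset.card_le_card h
    rw [card_arc (by omega), Finset.card_singleton] at this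
    omega
  · rw [Finset.sdiff_singleton_eq_erase, arc_erase hl hi']

/-! ### Elements of `φ(V_D)` have pairwise disjoint boundaries -/

/-- `p` is a boundary point of `I` if exactly one of `p - 1`, `p` lies in `I`. -/
def IsBoundary {D : ℕ} (I : Finset (ZMod (D + 1))) (p : ZMod (D + 1)) : Prop :=
  ¬ (p ∈ I ↔ p - 1 ∈ I)

theorem isBoundary_arc_iff {D l : ℕ} (h1 : 1 ≤ l) (hl : l ≤ D) (a p : ZMod (D + 1)) :
    IsBoundary (arc D a l) p ↔ p = a ∨ p = a + (l : ZMod (D + 1)) := by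
  rw [← arc_start_iff h1 hl a p, ← arc_end_iff h1 hl a p]
  unfold IsBoundary
  tauto

theorem exists_between_of_mem_evSet {D : ℕ} (hD : Even D) {B : Finset (Finset (ZMod (D + 1)))}
    (hB : phi D B) {I K : Finset (ZMod (D + 1))} (hI : I ∈ B) (hK : K ∈ B)
    {x y : ZMod (D + 1)} (hx : x ∈ evSet D I) (hxK : x ∉ K) (hyK : y ∈ K)
    (hxy : y = x - 1 ∨ x = y - 1) :
    ∃ J ∈ B, J ⊂ I ∧ K ⊂ J := by
  obtain ⟨𝒥, h𝒥B, hprec, -, hcov⟩ := hB.2.2 I hI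
  obtain ⟨J, hJ, hxJ⟩ := Finset.mem_biUnion.1 (hcov hx)
  rw [id] at hxJ
  refine ⟨J, h𝒥B hJ, (hprec J hJ).1, ?_⟩
  rcases hB.2.1 K hK J (h𝒥B hJ) with h | h | h | h
  · exact absurd (h ▸ hxJ) hxK
  · rcases hxy with rfl | rfl
    · exact absurd hxJ (h.not_adjacent hD (hB.1 K hK) (hB.1 J (h𝒥B hJ)) hyK)
    · exact absurd hyK (h.symm.not_adjacent hD (hB.1 J (h𝒥B hJ)) (hB.1 K hK) hxJ)
  · exact h.1
  · exact absurd (h.1.1 hxJ) hxK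

theorem not_ssubset_of_common_start {D : ℕ} (hD : Even D) {B : Finset (Finset (ZMod (D + 1)))}
    (hB : phi D B) {I : Finset (ZMod (D + 1))} (hI : I ∈ B) {p : ZMod (D + 1)}
    (hpI : p - 1 ∉ I) (n : ℕ) : ∀ K ∈ B, I.card ≤ K.card + n → K ⊂ I → p ∉ K := by
  induction n with
  | zero => exact fun K _ hn hKI => absurd (Finset.card_lt_card hKI) (by omega)
  | succ n ih =>
    intro K hK hn hKI hpK
    obtain ⟨a, l, hl1, hlD, hlo, hIa⟩ := (hB.1 I hI).exists_arc
    obtain ⟨b, k, hk1, hkD, hko, hKb⟩ := (hB.1 K hK).exists_arc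
    obtain rfl : p = a := (arc_start_iff hl1 hlD a p).1 (by
      rw [← hIa]; exact ⟨hKI.1 hpK, hpI⟩)
    obtain rfl : p = b := (arc_start_iff hk1 hkD b p).1 (by
      rw [← hKb]; exact ⟨hpK, fun h => hpI (hKI.1 h)⟩)
    have hkl := Finset.card_lt_card hKI
    rw [hIa, hKb, card_arc (by omega), card_arc (by omega)] at hkl
    have hend := (arc_end_iff hk1 hkD p _).2 rfl
    rw [← hKb] at hend
    obtain ⟨J, hJ, hJI, hKJ⟩ := exists_between_of_mem_evSet hD hB hI hK
      (hIa ▸ mem_evSet_arc_of_odd hlD hlo hkl hko p) hend.1 hend.2 (Or.inl rfl)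
    exact ih J hJ (by have := Finset.card_lt_card hKJ; omega) hJI (hKJ.1 hpK)

theorem not_ssubset_of_common_end {D : ℕ} (hD : Even D) {B : Finset (Finset (ZMod (D + 1)))}
    (hB : phi D B) {I : Finset (ZMod (D + 1))} (hI : I ∈ B) {p : ZMod (D + 1)}
    (hpI : p ∉ I) (n : ℕ) : ∀ K ∈ B, I.card ≤ K.card + n → K ⊂ I → p - 1 ∉ K := by
  induction n with
  | zero => exact fun K _ hn hKI => absurd (Finset.card_lt_card hKI) (by omega)
  | succ n ih =>
    intro K hK hn hKI hpK
    obtain ⟨a, l, hl1, hlD, hlo, hIa⟩ := (hB.1 I hI).exists_arc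
    obtain ⟨b, k, hk1, hkD, hko, hKb⟩ := (hB.1 K hK).exists_arc
    have hpa : p = a + (l : ZMod (D + 1)) := (arc_end_iff hl1 hlD a p).1 (by
      rw [← hIa]; exact ⟨hpI, hKI.1 hpK⟩)
    have hpb : p = b + (k : ZMod (D + 1)) := (arc_end_iff hk1 hkD b p).1 (by
      rw [← hKb]; exact ⟨fun h => hpI (hKI.1 h), hpK⟩)
    have hkl := Finset.card_lt_card hKI
    rw [hIa, hKb, card_arc (by omega), card_arc (by omega)] at hkl
    have hstart := (arc_start_iff hk1 hkD b b).2 rfl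
    rw [← hKb] at hstart
    have hb : b - 1 = a + ((l - k - 1 : ℕ) : ZMod (D + 1)) := by
      rw [Nat.cast_sub (by omega), Nat.cast_sub (by omega),
        eq_sub_of_add_eq (hpb.symm.trans hpa)]
      push_cast; ring
    obtain ⟨J, hJ, hJI, hKJ⟩ := exists_between_of_mem_evSet (x := b - 1) hD hB hI hK (by
        rw [hb, hIa]
        refine mem_evSet_arc_of_odd hlD hlo (by omega) ?_ a
        obtain ⟨u, hu⟩ := hlo
        obtain ⟨v, hv⟩ := hko
        exact ⟨u - v - 1, by omega⟩) hstart.2 hstart.1 (Or.inr rfl)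
    exact ih J hJ (by have := Finset.card_lt_card hKJ; omega) hJI (hKJ.1 hpK)

theorem not_isBoundary_of_ssubset {D : ℕ} (hD : Even D) {B : Finset (Finset (ZMod (D + 1)))}
    (hB : phi D B) {I K : Finset (ZMod (D + 1))} (hI : I ∈ B) (hK : K ∈ B) (hKI : K ⊂ I)
    {p : ZMod (D + 1)} (hpK : IsBoundary K p) : ¬ IsBoundary I p := by
  have h1 := @hKI.1 p
  have h2 := @hKI.1 (p - 1)
  have h3 := fun h => not_ssubset_of_common_start hD hB hI (p := p) h I.card K hK (by omega) hKI
  have h4 := fun h => not_ssubset_of_common_end hD hB hI (p := p) h I.card K hK (by omega) hKI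
  unfold IsBoundary at *
  tauto

theorem eq_of_isBoundary {D : ℕ} (hD : Even D) {B : Finset (Finset (ZMod (D + 1)))}
    (hB : phi D B) {I K : Finset (ZMod (D + 1))} (hI : I ∈ B) (hK : K ∈ B)
    {p : ZMod (D + 1)} (hpI : IsBoundary I p) (hpK : IsBoundary K p) : I = K := by
  rcases hB.2.1 I hI K hK with h | h | h | h
  · exact h
  · exfalso
    have h1 : p - 1 ∈ I → p ∉ K := h.not_adjacent hD (hB.1 I hI) (hB.1 K hK)
    have h2 : p - 1 ∈ K → p ∉ I := h.symm.not_adjacent hD (hB.1 K hK) (hB.1 I hI)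
    have h3 : ∀ x, x ∈ I → x ∉ K := fun x hx hxK => by
      have := Finset.mem_inter.2 ⟨hx, hxK⟩
      simp [h.1] at this
    have h4 := h3 p
    have h5 := h3 (p - 1)
    unfold IsBoundary at *
    tauto
  · exact absurd hpK (not_isBoundary_of_ssubset hD hB hK hI h.1 hpI)
  · exact absurd hpI (not_isBoundary_of_ssubset hD hB hI hK h.1 hpK)

/-! ### The span determines the element of `φ(V_D)` -/

/-- The functional `x ↦ x_p - x_{p-1}` on `V_D`. -/
def boundaryFunctional (D : ℕ) (p : ZMod (D + 1)) : Vsp D →ₗ[ZMod 2] ZMod 2 :=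
  Submodule.liftQ _
    (LinearMap.proj (R := ZMod 2) (φ := fun _ : ZMod (D + 1) => ZMod 2) p -
      LinearMap.proj (R := ZMod 2) (φ := fun _ : ZMod (D + 1) => ZMod 2) (p - 1)) (by
    rw [Submodule.span_le]
    rintro _ rfl
    change (1 : ZMod 2) - 1 = 0
    exact sub_self 1)

theorem eSet_eq_mk (D : ℕ) (I : Finset (ZMod (D + 1))) :
    eSet D I = Submodule.Quotient.mk (fun i => if i ∈ I then 1 else 0) := by
  have : (fun i => if i ∈ I then 1 else 0 : Wsp D) = ∑ s ∈ I, Pi.single s 1 := by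
    ext i
    rw [Finset.sum_apply]
    simp [Pi.single_apply]
  rw [this]
  exact (map_sum (Submodule.mkQ (Submodule.span (ZMod 2) {allOnes D})) _ _).symm

theorem boundaryFunctional_eSet {D : ℕ} (I : Finset (ZMod (D + 1))) (p : ZMod (D + 1))
    [Decidable (IsBoundary I p)] :
    boundaryFunctional D p (eSet D I) = if IsBoundary I p then 1 else 0 := by
  rw [eSet_eq_mk]
  change (if p ∈ I then 1 else 0 : ZMod 2) - (if p - 1 ∈ I then 1 else 0) = _
  by_cases h1 : p ∈ I <;> by_cases h2 : p - 1 ∈ I <;> simp [IsBoundary, h1, h2]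

theorem subset_of_spanB_le {D : ℕ} (hD : Even D) {B B' : Finset (Finset (ZMod (D + 1)))}
    (hB : phi D B) (hB' : phi D B') (h : spanB D B ≤ spanB D B') : B ⊆ B' := by
  classical
  intro I hI
  have hmem : eSet D I ∈ spanB D B' :=
    h (Submodule.subset_span (Set.mem_image_of_mem _ hI))
  obtain ⟨a, l, hl1, hlD, hlo, hIa⟩ := (hB.1 I hI).exists_arc
  have hbI : ∀ p, IsBoundary I p ↔ p = a ∨ p = a + (l : ZMod (D + 1)) := by
    rw [hIa]; exact isBoundary_arc_iff hl1 hlD a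
  obtain ⟨J, hJ, hJa⟩ : ∃ J ∈ B', IsBoundary J a := by
    by_contra! hno
    have hle : spanB D B' ≤ LinearMap.ker (boundaryFunctional D a) := by
      rw [spanB, Submodule.span_le]
      rintro _ ⟨J, hJ, rfl⟩
      simp [boundaryFunctional_eSet, hno J hJ]
    have h1 := hle hmem
    rw [LinearMap.mem_ker, boundaryFunctional_eSet, if_pos ((hbI a).2 (Or.inl rfl))] at h1
    exact one_ne_zero h1
  obtain ⟨b, k, hk1, hkD, hko, hJb⟩ := (hB'.1 J hJ).exists_arc
  have hbJ : ∀ p, IsBoundary J p ↔ p = b ∨ p = b + (k : ZMod (D + 1)) := by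
    rw [hJb]; exact isBoundary_arc_iff hk1 hkD b
  have hsub : ∀ q, IsBoundary J q → IsBoundary I q := by
    intro q hq
    have hle : spanB D B' ≤
        LinearMap.ker (boundaryFunctional D a - boundaryFunctional D q) := by
      rw [spanB, Submodule.span_le]
      rintro _ ⟨K, hK, rfl⟩
      have : IsBoundary K a ↔ IsBoundary K q :=
        ⟨fun h => eq_of_isBoundary hD hB' hJ hK hJa h ▸ hq,
          fun h => eq_of_isBoundary hD hB' hJ hK hq h ▸ hJa⟩
      simp [boundaryFunctional_eSet, this]
    have h1 := hle hmem
    rw [LinearMap.mem_ker, LinearMap.sub_apply, boundaryFunctional_eSet,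
      boundaryFunctional_eSet, if_pos ((hbI a).2 (Or.inl rfl))] at h1
    by_contra hn
    rw [if_neg hn] at h1
    simp at h1
  have hb := (hbI _).1 (hsub b ((hbJ b).2 (Or.inl rfl)))
  have hbk := (hbI _).1 (hsub _ ((hbJ _).2 (Or.inr rfl)))
  have hk0 : (k : ZMod (D + 1)) ≠ 0 := fun h => by
    have := natCast_inj_of_le hkD (Nat.zero_le D) (by simpa using h)
    omega
  rcases hb with rfl | rfl
  · rcases hbk with h1 | h1
    · exact absurd (by simpa using h1) hk0
    · rw [hIa, ← natCast_inj_of_le hkD hlD (add_left_cancel h1), ← hJb]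
      exact hJ
  · exfalso
    rcases hbk with h1 | h1
    · rw [add_assoc, add_eq_left, ← Nat.cast_add, ZMod.natCast_eq_zero_iff] at h1
      obtain ⟨c, hc⟩ := h1
      obtain rfl : c = 1 := by
        rcases c with _ | _ | c
        · omega
        · rfl
        · rw [mul_add] at hc
          have : 0 ≤ (D + 1) * c := Nat.zero_le _
          nlinarith
      have := hlo.add_odd hko
      rw [hc, mul_one] at this
      exact Nat.not_even_iff_odd.2 hD.add_one this
    · exact hk0 (by simpa using h1)

theorem spanB_injOn {D : ℕ} (hD : Even D) {B B' : Finset (Finset (ZMod (D + 1)))}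
    (hB : phi D B) (hB' : phi D B') (h : spanB D B = spanB D B') : B = B' :=
  Finset.Subset.antisymm (subset_of_spanB_le hD hB hB' h.le) (subset_of_spanB_le hD hB' hB h.ge)

/-! ### Collapsing three consecutive points of the circle -/

/-- `σ` is the degree one map `Z/(D+1) → Z/(m+1)` collapsing `c - 1, c, c + 1` to one point. -/
structure IsCollapse {D m : ℕ} (σ : ZMod (D + 1) → ZMod (m + 1)) (c : ZMod (D + 1)) : Prop where
  surj : Function.Surjective σ
  pred : σ (c - 1) = σ c
  succ : σ (c + 1) = σ c
  step : ∀ i, i ≠ c → i ≠ c + 1 → σ (i - 1) = σ i - 1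
  fiber : ∀ i k, σ i = σ k → i = k ∨ σ i = σ c
  fiber_center : ∀ i, σ i = σ c → i = c - 1 ∨ i = c ∨ i = c + 1
  card : m + 2 = D

namespace IsCollapse

variable {D m : ℕ} {σ : ZMod (D + 1) → ZMod (m + 1)} {c : ZMod (D + 1)}

theorem one_ne_zero (h : IsCollapse σ c) : (1 : ZMod (D + 1)) ≠ 0 := by
  have := h.card
  intro h0
  have := natCast_inj_of_le (D := D) (s := 1) (t := 0) (by omega) (by omega) (by simpa using h0)
  omega

theorem two_ne_zero (h : IsCollapse σ c) : (2 : ZMod (D + 1)) ≠ 0 := by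
  have := h.card
  intro h0
  have := natCast_inj_of_le (D := D) (s := 2) (t := 0) (by omega) (by omega) (by simpa using h0)
  omega

theorem pred_ne (h : IsCollapse σ c) : c - 1 ≠ c := by simp [h.one_ne_zero]

theorem succ_ne (h : IsCollapse σ c) : c + 1 ≠ c := by simp [h.one_ne_zero]

theorem pred_ne_succ (h : IsCollapse σ c) : c - 1 ≠ c + 1 := fun h' =>
  h.two_ne_zero (by linear_combination -h')

end IsCollapse

/-- The preimage of a subset of the circle. -/
def pre {D m : ℕ} (σ : ZMod (D + 1) → ZMod (m + 1)) (K : Finset (ZMod (m + 1))) :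
    Finset (ZMod (D + 1)) := Finset.univ.filter (fun i => σ i ∈ K)

namespace IsCollapse

variable {D m : ℕ} {σ : ZMod (D + 1) → ZMod (m + 1)} {c : ZMod (D + 1)}

theorem _root_.mem_pre {K : Finset (ZMod (m + 1))} {i : ZMod (D + 1)} :
    i ∈ pre σ K ↔ σ i ∈ K := by simp [pre]

theorem _root_.pre_union (K L : Finset (ZMod (m + 1))) :
    pre σ (K ∪ L) = pre σ K ∪ pre σ L := by
  ext; simp [mem_pre]

theorem _root_.pre_inter (K L : Finset (ZMod (m + 1))) :
    pre σ (K ∩ L) = pre σ K ∩ pre σ L := by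
  ext; simp [mem_pre]

theorem _root_.pre_sdiff (K L : Finset (ZMod (m + 1))) :
    pre σ (K \ L) = pre σ K \ pre σ L := by
  ext; simp [mem_pre]

theorem pre_injective (h : IsCollapse σ c) : Function.Injective (pre σ) := by
  intro K L hKL
  ext s
  obtain ⟨i, rfl⟩ := h.surj s
  rw [← mem_pre, ← mem_pre, hKL]

theorem pre_ssubset (h : IsCollapse σ c) {K L : Finset (ZMod (m + 1))} (hKL : K ⊂ L) :
    pre σ K ⊂ pre σ L := by
  have hle : pre σ K ⊆ pre σ L := fun i hi => mem_pre.2 (hKL.1 (mem_pre.1 hi))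
  exact hle.ssubset_of_ne fun he => hKL.ne (h.pre_injective he)

theorem start_iff (h : IsCollapse σ c) {K : Finset (ZMod (m + 1))} {i : ZMod (D + 1)} :
    (i ∈ pre σ K ∧ i - 1 ∉ pre σ K) ↔
      (σ i ∈ K ∧ σ i - 1 ∉ K) ∧ i ≠ c ∧ i ≠ c + 1 := by
  rw [mem_pre, mem_pre]
  by_cases h1 : i = c
  · subst h1; simp [h.pred]
  by_cases h2 : i = c + 1
  · subst h2; simp [h.succ]
  rw [h.step i h1 h2]
  simp [h1, h2]

theorem exists_lift (h : IsCollapse σ c) (s : ZMod (m + 1)) :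
    ∃! i, σ i = s ∧ i ≠ c ∧ i ≠ c + 1 := by
  have huniq : ∀ i k, σ i = σ k → i ≠ c → i ≠ c + 1 → k ≠ c → k ≠ c + 1 → i = k := by
    intro i k hik h1 h2 h3 h4
    rcases h.fiber i k hik with h5 | h5
    · exact h5
    · have := h.fiber_center i h5
      have := h.fiber_center k (hik ▸ h5)
      simp_all
  obtain ⟨i, rfl⟩ := h.surj s
  by_cases hi : σ i = σ c
  · exact ⟨c - 1, ⟨by rw [hi, h.pred], h.pred_ne, h.pred_ne_succ⟩, fun k hk =>
      huniq k (c - 1) (by rw [hk.1, hi, h.pred]) hk.2.1 hk.2.2 h.pred_ne h.pred_ne_succ⟩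
  · have h1 : i ≠ c := fun h' => hi (by rw [h'])
    have h2 : i ≠ c + 1 := fun h' => hi (by rw [h', h.succ])
    exact ⟨i, ⟨rfl, h1, h2⟩, fun k hk => huniq k i hk.1 hk.2.1 hk.2.2 h1 h2⟩

theorem isInterval_pre_iff (h : IsCollapse σ c) (K : Finset (ZMod (m + 1))) :
    IsInterval D (pre σ K) ↔ IsInterval m K := by
  rw [isInterval_iff, isInterval_iff]
  simp only [h.start_iff]
  constructor
  · rintro ⟨i, hi, hu⟩
    refine ⟨σ i, hi.1, fun s hs => ?_⟩
    obtain ⟨k, ⟨rfl, hk⟩, -⟩ := h.exists_lift s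
    rw [hu k ⟨hs, hk⟩]
  · rintro ⟨s, hs, hu⟩
    obtain ⟨k, ⟨rfl, hk⟩, hku⟩ := h.exists_lift s
    exact ⟨k, ⟨hs, hk⟩, fun i hi => hku i ⟨hu _ hi.1, hi.2⟩⟩

theorem odd_card_pre (h : IsCollapse σ c) {K : Finset (ZMod (m + 1))} (hK : Odd K.card) :
    Odd (pre σ K).card := by
  have h1 : ((pre σ K).filter (fun i => i ≠ c ∧ i ≠ c + 1)).card = K.card := by
    refine Finset.card_bij (fun i _ => σ i) ?_ ?_ ?_
    · intro i hi
      exact mem_pre.1 (Finset.mem_filter.1 hi).1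
    · intro i hi k hk hik
      exact (h.exists_lift (σ k)).unique ⟨hik, (Finset.mem_filter.1 hi).2⟩
        ⟨rfl, (Finset.mem_filter.1 hk).2⟩
    · intro s hs
      obtain ⟨k, ⟨rfl, hk⟩, -⟩ := h.exists_lift s
      exact ⟨k, Finset.mem_filter.2 ⟨mem_pre.2 hs, hk⟩, rfl⟩
  have h2 : Even ((pre σ K).filter (fun i => ¬ (i ≠ c ∧ i ≠ c + 1))).card := by
    by_cases hc : σ c ∈ K
    · have : (pre σ K).filter (fun i => ¬ (i ≠ c ∧ i ≠ c + 1)) = {c, c + 1} := by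
        ext i
        rw [Finset.mem_filter, mem_pre, Finset.mem_insert, Finset.mem_singleton]
        constructor
        · tauto
        · rintro (rfl | rfl)
          · simp [hc]
          · simp [h.succ, hc]
      rw [this, Finset.card_pair h.succ_ne.symm]
      decide
    · have : (pre σ K).filter (fun i => ¬ (i ≠ c ∧ i ≠ c + 1)) = ∅ := by
        ext i
        simp only [Finset.mem_filter, mem_pre, Finset.notMem_empty, iff_false]
        rintro ⟨hi, hi'⟩
        apply hc
        by_cases h3 : i = c
        · rwa [← h3]
        · have h4 : i = c + 1 := by tauto
          rwa [← h.succ, ← h4]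
      rw [this]
      simp
  rw [← Finset.card_filter_add_card_filter_not (s := pre σ K) (fun i => i ≠ c ∧ i ≠ c + 1), h1]
  exact hK.add_even h2

theorem oddInterval_pre (h : IsCollapse σ c) {K : Finset (ZMod (m + 1))}
    (hK : OddInterval m K) : OddInterval D (pre σ K) :=
  ⟨(h.isInterval_pre_iff K).2 hK.1, h.odd_card_pre hK.2⟩

theorem prec_pre (h : IsCollapse σ c) {K L : Finset (ZMod (m + 1))} (hKL : Prec m K L) :
    Prec D (pre σ K) (pre σ L) := by
  obtain ⟨hss, I₁, I₂, h1, h2, hd, he⟩ := hKL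
  refine ⟨h.pre_ssubset hss, pre σ I₁, pre σ I₂, (h.isInterval_pre_iff _).2 h1,
    (h.isInterval_pre_iff _).2 h2, ?_, by rw [← pre_sdiff, he, pre_union]⟩
  rw [Finset.disjoint_left] at hd ⊢
  exact fun i hi hi' => hd (mem_pre.1 hi) (mem_pre.1 hi')

theorem spade_pre (h : IsCollapse σ c) {K L : Finset (ZMod (m + 1))} (hKL : Spade m K L) :
    Spade D (pre σ K) (pre σ L) := by
  refine ⟨?_, by rw [← pre_union, h.isInterval_pre_iff]; exact hKL.2⟩
  rw [← pre_inter, hKL.1]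
  simp [pre]

theorem isInterval_singleton (h : IsCollapse σ c) : IsInterval D {c} := by
  have := h.card
  exact ⟨c, 1, le_rfl, by omega, by simp⟩

theorem singleton_prec_pre (h : IsCollapse σ c) {K : Finset (ZMod (m + 1))}
    (hK : IsInterval m K) (hc : σ c ∈ K) : Prec D {c} (pre σ K) :=
  IsInterval.singleton_prec ((h.isInterval_pre_iff K).2 hK) (mem_pre.2 hc)
    (mem_pre.2 (h.pred ▸ hc)) (mem_pre.2 (h.succ ▸ hc))

theorem singleton_spade_pre (h : IsCollapse σ c) {K : Finset (ZMod (m + 1))}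
    (hK : IsInterval m K) (hc : σ c ∉ K) : Spade D {c} (pre σ K) := by
  have hcp : c ∉ pre σ K := fun h' => hc (mem_pre.1 h')
  refine ⟨Finset.singleton_inter_of_notMem hcp, fun hI => ?_⟩
  obtain ⟨i, ⟨hi, hi1⟩, -⟩ := (isInterval_iff _).1 ((h.isInterval_pre_iff K).2 hK)
  refine hcp ((?_ : i = c) ▸ hi)
  refine ((isInterval_iff _).1 hI).unique ⟨Finset.mem_union_right _ hi, ?_⟩
    ⟨Finset.mem_union_left _ (Finset.mem_singleton_self c), ?_⟩
  · rw [Finset.mem_union, Finset.mem_singleton, not_or]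
    refine ⟨fun h' => hc ?_, hi1⟩
    rw [← h.succ, ← h', sub_add_cancel]
    exact mem_pre.1 hi
  · rw [Finset.mem_union, Finset.mem_singleton, not_or, mem_pre, h.pred]
    exact ⟨h.pred_ne, hc⟩

theorem mem_evSet_of_mem_evSet_pre (h : IsCollapse σ c) {K : Finset (ZMod (m + 1))}
    (hK : OddInterval m K) {i : ZMod (D + 1)} (hi : i ∈ evSet D (pre σ K)) (hic : i ≠ c) :
    σ i ∈ evSet m K := by
  have hP := h.oddInterval_pre hK
  have key : ∀ i ∈ pre σ K, (i ≠ c → (i ∈ evSet D (pre σ K) ↔ σ i ∈ evSet m K)) ∧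
      (i = c → (i ∈ evSet D (pre σ K) ↔ σ i ∉ evSet m K)) := by
    refine hP.induction_on ?_ ?_
    · intro i hi hi1
      have hs := h.start_iff.1 ⟨hi, hi1⟩
      refine ⟨fun _ => ?_, fun h' => absurd h' hs.2.1⟩
      rw [mem_evSet_iff_pred hP hi, mem_evSet_iff_pred hK hs.1.1]
      tauto
    · intro i hi hi1 ih
      rw [mem_evSet_iff_pred hP hi]
      by_cases h1 : i = c
      · subst h1
        have := ih.1 h.pred_ne
        rw [h.pred] at this
        tauto
      by_cases h2 : i = c + 1
      · subst h2
        rw [add_sub_cancel_right] at ih hi1 ⊢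
        have := ih.2 rfl
        rw [h.succ]
        tauto
      have hs := h.step i h1 h2
      have ih1 := ih.1 fun h3 => h2 (by rw [← h3, sub_add_cancel])
      rw [hs] at ih1
      have hK1 := mem_pre.1 hi1
      rw [hs] at hK1
      rw [mem_evSet_iff_pred hK (mem_pre.1 hi)]
      tauto
  exact ((key i (mem_of_mem_evSet hi)).1 hic).1 hi

/-- The element `t_j(C)` of `φ(V_D)` attached to `C ∈ φ(V_{D-2})`. -/
def _root_.expand (σ : ZMod (D + 1) → ZMod (m + 1)) (c : ZMod (D + 1))
    (C : Finset (Finset (ZMod (m + 1)))) : Finset (Finset (ZMod (D + 1))) :=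
  insert {c} (C.image (pre σ))

theorem singleton_ne_pre (h : IsCollapse σ c) (K : Finset (ZMod (m + 1))) : {c} ≠ pre σ K := by
  intro he
  have h1 : c ∈ pre σ K := he ▸ Finset.mem_singleton_self c
  have h2 : c - 1 ∈ pre σ K := mem_pre.2 (h.pred ▸ mem_pre.1 h1)
  rw [← he, Finset.mem_singleton] at h2
  exact h.pred_ne h2

theorem pre_mem_expand_iff (h : IsCollapse σ c) {C : Finset (Finset (ZMod (m + 1)))}
    {K : Finset (ZMod (m + 1))} : pre σ K ∈ expand σ c C ↔ K ∈ C := by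
  unfold expand
  rw [Finset.mem_insert, Finset.mem_image]
  constructor
  · rintro (h' | ⟨L, hL, he⟩)
    · exact absurd h'.symm (h.singleton_ne_pre K)
    · exact h.pre_injective he ▸ hL
  · exact fun hK => Or.inr ⟨K, hK, rfl⟩

theorem expand_injective (h : IsCollapse σ c) : Function.Injective (expand σ c) := by
  intro C C' he
  ext K
  rw [← h.pre_mem_expand_iff, he, h.pre_mem_expand_iff]

theorem phi_expand (h : IsCollapse σ c) {C : Finset (Finset (ZMod (m + 1)))} (hC : phi m C) :
    phi D (expand σ c C) := by
  have hodd : OddInterval D {c} := ⟨h.isInterval_singleton, by simp⟩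
  have hcase : ∀ I, I ∈ expand σ c C ↔ I = {c} ∨ ∃ K ∈ C, I = pre σ K := by
    intro I
    simp only [expand, Finset.mem_insert, Finset.mem_image, eq_comm]
  have hcK : ∀ K ∈ C, Spade D {c} (pre σ K) ∨ Prec D {c} (pre σ K) := by
    intro K hK
    by_cases hc : σ c ∈ K
    · exact Or.inr (h.singleton_prec_pre (hC.1 K hK).1 hc)
    · exact Or.inl (h.singleton_spade_pre (hC.1 K hK).1 hc)
  refine ⟨?_, ?_, ?_⟩
  · intro I hI
    rcases (hcase I).1 hI with rfl | ⟨K, hK, rfl⟩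
    · exact hodd
    · exact h.oddInterval_pre (hC.1 K hK)
  · intro I hI J hJ
    rcases (hcase I).1 hI with rfl | ⟨K, hK, rfl⟩ <;>
      rcases (hcase J).1 hJ with rfl | ⟨L, hL, rfl⟩
    · exact Or.inl rfl
    · exact Or.inr ((hcK L hL).imp id Or.inl)
    · exact Or.inr ((hcK K hK).imp Spade.symm Or.inr)
    · rcases hC.2.1 K hK L hL with rfl | h' | h' | h'
      · exact Or.inl rfl
      · exact Or.inr (Or.inl (h.spade_pre h'))
      · exact Or.inr (Or.inr (Or.inl (h.prec_pre h')))
      · exact Or.inr (Or.inr (Or.inr (h.prec_pre h')))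
  · intro I hI
    rcases (hcase I).1 hI with rfl | ⟨K, hK, rfl⟩
    · refine ⟨∅, by simp, by simp, by simp, fun i hi => ?_⟩
      have hmem := mem_of_mem_evSet hi
      have h1 := ((mem_evSet_iff_pred hodd hmem).1 hi).1
      rw [Finset.mem_singleton] at hmem h1
      exact absurd (hmem ▸ h1) h.pred_ne
    · obtain ⟨𝒥, h𝒥, hprec, hdisj, hcov⟩ := hC.2.2 K hK
      have hpd : ∀ J L : Finset (ZMod (m + 1)), Disjoint J L → Disjoint (pre σ J) (pre σ L) := by
        intro J L hJL
        rw [Finset.disjoint_iff_inter_eq_empty] at hJL ⊢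
        rw [← pre_inter, hJL]
        simp [pre]
      have hcov' : ∀ i ∈ evSet D (pre σ K), i ≠ c → ∃ J ∈ 𝒥, i ∈ pre σ J := by
        intro i hi hic
        obtain ⟨J, hJ, hiJ⟩ := Finset.mem_biUnion.1
          (hcov (h.mem_evSet_of_mem_evSet_pre (hC.1 K hK) hi hic))
        exact ⟨J, hJ, mem_pre.2 hiJ⟩
      by_cases hc : (∃ J ∈ 𝒥, σ c ∈ J) ∨ σ c ∉ K
      · refine ⟨𝒥.image (pre σ), ?_, ?_, ?_, ?_⟩
        · intro I hI
          obtain ⟨J, hJ, rfl⟩ := Finset.mem_image.1 hI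
          exact h.pre_mem_expand_iff.2 (h𝒥 hJ)
        · intro I hI
          obtain ⟨J, hJ, rfl⟩ := Finset.mem_image.1 hI
          exact h.prec_pre (hprec J hJ)
        · intro I hI I' hI' hne
          obtain ⟨J, hJ, rfl⟩ := Finset.mem_image.1 hI
          obtain ⟨L, hL, rfl⟩ := Finset.mem_image.1 hI'
          exact hpd J L (hdisj J hJ L hL fun h' => hne (by rw [h']))
        · intro i hi
          have : ∃ J ∈ 𝒥, i ∈ pre σ J := by
            by_cases hic : i = c
            · subst hic
              rcases hc with ⟨J, hJ, hcJ⟩ | hcK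
              · exact ⟨J, hJ, mem_pre.2 hcJ⟩
              · exact absurd (mem_pre.1 (mem_of_mem_evSet hi)) hcK
            · exact hcov' i hi hic
          obtain ⟨J, hJ, hiJ⟩ := this
          exact Finset.mem_biUnion.2 ⟨pre σ J, Finset.mem_image_of_mem _ hJ, hiJ⟩
      · push Not at hc
        have hcd : ∀ J ∈ 𝒥, Disjoint {c} (pre σ J) := fun J hJ =>
          Finset.disjoint_singleton_left.2 fun h' => hc.1 J hJ (mem_pre.1 h')
        refine ⟨expand σ c 𝒥, ?_, ?_, ?_, ?_⟩
        · exact Finset.insert_subset_insert _ (Finset.image_subset_image h𝒥)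
        · intro I hI
          rcases Finset.mem_insert.1 hI with rfl | hI
          · exact h.singleton_prec_pre (hC.1 K hK).1 hc.2
          obtain ⟨J, hJ, rfl⟩ := Finset.mem_image.1 hI
          exact h.prec_pre (hprec J hJ)
        · intro I hI I' hI' hne
          rcases Finset.mem_insert.1 hI with rfl | hI <;>
            rcases Finset.mem_insert.1 hI' with rfl | hI'
          · exact absurd rfl hne
          · obtain ⟨L, hL, rfl⟩ := Finset.mem_image.1 hI'
            exact hcd L hL
          · obtain ⟨J, hJ, rfl⟩ := Finset.mem_image.1 hI
            exact (hcd J hJ).symm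
          · obtain ⟨J, hJ, rfl⟩ := Finset.mem_image.1 hI
            obtain ⟨L, hL, rfl⟩ := Finset.mem_image.1 hI'
            exact hpd J L (hdisj J hJ L hL fun h' => hne (by rw [h']))
        · intro i hi
          rw [Finset.mem_biUnion]
          by_cases hic : i = c
          · exact ⟨{c}, Finset.mem_insert_self _ _, Finset.mem_singleton.2 hic⟩
          · obtain ⟨J, hJ, hiJ⟩ := hcov' i hi hic
            exact ⟨pre σ J, h.pre_mem_expand_iff.2 hJ, hiJ⟩

end IsCollapse

/-! ### The linear map attached to a collapse -/

theorem sum_eV (D : ℕ) : ∑ i, eV D i = 0 := by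
  have h := eSet_eq_mk D Finset.univ
  rw [eSet] at h
  rw [h, Submodule.Quotient.mk_eq_zero]
  refine Submodule.mem_span_singleton.2 ⟨1, ?_⟩
  ext i
  simp [allOnes]

/-- The linear map sending `e'_s` to `∑_{σ i = s} e_i`. -/
noncomputable def pullback {D m : ℕ} (σ : ZMod (D + 1) → ZMod (m + 1)) :
    Vsp m →ₗ[ZMod 2] Vsp D :=
  Submodule.liftQ _ (Fintype.linearCombination (ZMod 2) fun s => eSet D (pre σ {s})) (by
    rw [Submodule.span_le]
    rintro _ rfl
    change Fintype.linearCombination (ZMod 2) (fun s => eSet D (pre σ {s})) (allOnes m) = 0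
    rw [Fintype.linearCombination_apply]
    simp only [allOnes, one_smul, eSet, pre, Finset.mem_singleton]
    rw [Finset.sum_fiberwise, sum_eV])

theorem pullback_mk {D m : ℕ} (σ : ZMod (D + 1) → ZMod (m + 1)) (w : Wsp m) :
    pullback σ (Submodule.Quotient.mk w) = ∑ i, w (σ i) • eV D i := by
  change Fintype.linearCombination (ZMod 2) (fun s => eSet D (pre σ {s})) w = _
  rw [Fintype.linearCombination_apply]
  simp only [eSet, pre, Finset.mem_singleton, Finset.smul_sum]
  rw [← Finset.sum_fiberwise Finset.univ σ]
  refine Finset.sum_congr rfl fun s _ => Finset.sum_congr rfl fun i hi => ?_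
  rw [(Finset.mem_filter.1 hi).2]

theorem sum_smul_eV (D : ℕ) (f : ZMod (D + 1) → ZMod 2) :
    ∑ i, f i • eV D i = Submodule.Quotient.mk f := by
  have : f = ∑ i, f i • Pi.single i (1 : ZMod 2) := by
    ext k
    rw [Finset.sum_apply]
    simp [Pi.single_apply]
  conv_rhs => rw [this]
  exact (map_sum (Submodule.mkQ (Submodule.span (ZMod 2) {allOnes D})) _ _).symm

theorem pullback_eSet {D m : ℕ} (σ : ZMod (D + 1) → ZMod (m + 1)) (K : Finset (ZMod (m + 1))) :
    pullback σ (eSet m K) = eSet D (pre σ K) := by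
  rw [eSet_eq_mk, pullback_mk, sum_smul_eV, eSet_eq_mk]
  simp only [mem_pre]

theorem mem_spanB_expand {D m : ℕ} {σ : ZMod (D + 1) → ZMod (m + 1)} {c : ZMod (D + 1)}
    {C : Finset (Finset (ZMod (m + 1)))} {x : Vsp D} :
    x ∈ spanB D (expand σ c C) ↔
      ∃ y ∈ spanB m C, ∃ a : ZMod 2, x = pullback σ y + a • eV D c := by
  have hc : eSet D {c} = eV D c := by simp [eSet]
  have himg : eSet D '' ((C.image (pre σ) : Finset _) : Set (Finset (ZMod (D + 1)))) =
      pullback σ '' (eSet m '' (C : Set (Finset (ZMod (m + 1))))) := by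
    rw [Finset.coe_image, Set.image_image, Set.image_image]
    simp only [pullback_eSet]
  rw [spanB, expand, Finset.coe_insert, Set.image_insert_eq, Submodule.mem_span_insert, hc, himg,
    ← Submodule.map_span]
  constructor
  · rintro ⟨a, z, ⟨y, hy, rfl⟩, rfl⟩
    exact ⟨y, hy, a, add_comm _ _⟩
  · rintro ⟨y, hy, a, rfl⟩
    exact ⟨a, _, ⟨y, hy, rfl⟩, add_comm _ _⟩

theorem IsCollapse.gB_expand {D m : ℕ} {σ : ZMod (D + 1) → ZMod (m + 1)} {c : ZMod (D + 1)}
    (h : IsCollapse σ c) (C : Finset (Finset (ZMod (m + 1)))) {i : ZMod (D + 1)} (hi : i ≠ c) :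
    gB D (expand σ c C) i = gB m C (σ i) := by
  unfold gB expand
  rw [Finset.filter_insert, if_neg (by simpa using hi), Finset.filter_image,
    Finset.card_image_of_injective _ h.pre_injective]
  simp only [mem_pre]

theorem IsCollapse.epsB_expand {D m : ℕ} {σ : ZMod (D + 1) → ZMod (m + 1)} {c : ZMod (D + 1)}
    (h : IsCollapse σ c) (C : Finset (Finset (ZMod (m + 1)))) :
    ∃ a : ZMod 2, epsB D (expand σ c C) = pullback σ (epsB m C) + a • eV D c := by
  let f : ZMod (m + 1) → ZMod 2 := fun s => ((gB m C s * (gB m C s + 1) / 2 : ℕ) : ZMod 2)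
  let g : ZMod (D + 1) → ZMod 2 := fun i =>
    ((gB D (expand σ c C) i * (gB D (expand σ c C) i + 1) / 2 : ℕ) : ZMod 2)
  refine ⟨g c - f (σ c), ?_⟩
  have h1 : epsB m C = Submodule.Quotient.mk f := sum_smul_eV m f
  rw [h1, pullback_mk]
  change ∑ i, g i • eV D i = _
  rw [← sub_eq_iff_eq_add', ← Finset.sum_sub_distrib, Finset.sum_eq_single c]
  · rw [sub_smul]
  · intro i _ hi
    have : g i = f (σ i) := by simp only [g, f, h.gB_expand C hi]
    rw [this, sub_self]
  · simp

theorem IsCollapse.leφ_expand {D m : ℕ} {σ : ZMod (D + 1) → ZMod (m + 1)} {c : ZMod (D + 1)}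
    (h : IsCollapse σ c) {C C' : Finset (Finset (ZMod (m + 1)))} (hle : leφ m C C') :
    leφ D (expand σ c C) (expand σ c C') := by
  obtain ⟨k, b, rfl, rfl, hphi, heps⟩ := hle
  refine ⟨k, fun s => expand σ c (b s), rfl, rfl, fun s hs => h.phi_expand (hphi s hs),
    fun s hs => ?_⟩
  obtain ⟨a, ha⟩ := h.epsB_expand (b s)
  exact mem_spanB_expand.2 ⟨_, heps s hs, a, ha⟩

/-! ### The collapse attached to `j` -/

/-- The map collapsing `j - 1, j, j + 1` to `j - 1`. -/
def collapse (D j : ℕ) (i : ZMod (D + 1)) : ZMod (D - 2 + 1) :=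
  ((j - 1 + min (i - ((j : ZMod (D + 1)) + 1)).val (D - 1) : ℕ) : ZMod (D - 2 + 1))

theorem collapse_add {D : ℕ} (j : ℕ) {t : ℕ} (ht : t ≤ D) :
    collapse D j ((j : ZMod (D + 1)) + 1 + (t : ZMod (D + 1))) =
      ((j - 1 + min t (D - 1) : ℕ) : ZMod (D - 2 + 1)) := by
  unfold collapse
  rw [add_sub_cancel_left, ZMod.val_natCast, Nat.mod_eq_of_lt (by omega)]

theorem natCast_add_inj {m a s t : ℕ} (hs : s ≤ m) (ht : t ≤ m)
    (h : ((a + s : ℕ) : ZMod (m + 1)) = ((a + t : ℕ) : ZMod (m + 1))) : s = t :=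
  natCast_inj_of_le hs ht (by push_cast at h; exact add_left_cancel h)

theorem natCast_add_period {m a b : ℕ} (h : a = b + (m + 1)) :
    (a : ZMod (m + 1)) = (b : ZMod (m + 1)) := by
  rw [h, Nat.cast_add, ZMod.natCast_self, add_zero]

theorem collapse_center {D : ℕ} (hD : 4 ≤ D) (j : ℕ) :
    collapse D j (j : ZMod (D + 1)) = ((j - 1 : ℕ) : ZMod (D - 2 + 1)) := by
  have h1 : (j : ZMod (D + 1)) = (j : ZMod (D + 1)) + 1 + ((D : ℕ) : ZMod (D + 1)) := by
    rw [natCast_eq_neg_one]; ring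
  rw [h1, collapse_add j le_rfl]
  exact natCast_add_period (by omega)

theorem isCollapse_collapse {D : ℕ} (hD : 4 ≤ D) (j : ℕ) :
    IsCollapse (collapse D j) (j : ZMod (D + 1)) := by
  set J : ZMod (D + 1) := (j : ZMod (D + 1)) with hJ
  have hDc : J = J + 1 + ((D : ℕ) : ZMod (D + 1)) := by rw [natCast_eq_neg_one]; ring
  have hDp : J - 1 = J + 1 + ((D - 1 : ℕ) : ZMod (D + 1)) := by
    rw [Nat.cast_sub (by omega), natCast_eq_neg_one]; push_cast; ring
  have h0 : J + 1 = J + 1 + ((0 : ℕ) : ZMod (D + 1)) := by simp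
  have hc : collapse D j J = ((j - 1 + (D - 1) : ℕ) : ZMod (D - 2 + 1)) := by
    rw [hDc, collapse_add j le_rfl, min_eq_right (by omega)]
  have hc0 : collapse D j J = ((j - 1 + 0 : ℕ) : ZMod (D - 2 + 1)) := by
    rw [hc]; exact natCast_add_period (by omega)
  have hcen : ∀ t, t ≤ D → collapse D j (J + 1 + (t : ZMod (D + 1))) = collapse D j J →
      t = D - 1 ∨ t = D ∨ t = 0 := by
    intro t ht he
    by_contra! hne
    rw [hc0, collapse_add j ht, min_eq_left (by omega)] at he
    have := natCast_add_inj (by omega) (by omega) he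
    omega
  refine ⟨?_, ?_, ?_, ?_, ?_, ?_, by omega⟩
  · intro s
    obtain ⟨t, ht, rfl⟩ := exists_eq_add_natCast ((j - 1 : ℕ) : ZMod (D - 2 + 1)) s
    refine ⟨J + 1 + (t : ZMod (D + 1)), ?_⟩
    rw [collapse_add j (by omega), min_eq_left (by omega), Nat.cast_add]
  · rw [hc, hDp, collapse_add j (by omega), min_eq_left (by omega)]
  · rw [hc0, h0, collapse_add j (by omega), min_eq_left (by omega)]
  · intro i h1 h2
    obtain ⟨t, ht, rfl⟩ := exists_eq_add_natCast (J + 1) i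
    rcases t with _ | t
    · exact absurd h0.symm h2
    have htD : t + 1 ≠ D := by
      intro h'
      rw [h'] at h1
      exact h1 hDc.symm
    rw [add_natCast_succ_sub_one, collapse_add j ht, collapse_add j (by omega),
      min_eq_left (by omega), min_eq_left (by omega)]
    push_cast
    ring
  · intro i k hik
    obtain ⟨s, hs, rfl⟩ := exists_eq_add_natCast (J + 1) i
    obtain ⟨t, ht, rfl⟩ := exists_eq_add_natCast (J + 1) k
    by_contra! hne
    have hs1 : s < D - 1 := by
      by_contra h'
      apply hne.2
      rw [hc, collapse_add j hs, min_eq_right (by omega)]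
    have ht1 : t < D - 1 := by
      by_contra h'
      apply hne.2
      rw [hik, hc, collapse_add j ht, min_eq_right (by omega)]
    rw [collapse_add j hs, collapse_add j ht, min_eq_left (by omega), min_eq_left (by omega)] at hik
    exact hne.1 (by rw [natCast_add_inj (by omega) (by omega) hik])
  · intro i hi
    obtain ⟨t, ht, rfl⟩ := exists_eq_add_natCast (J + 1) i
    rcases hcen t ht hi with rfl | rfl | rfl
    · exact Or.inl hDp.symm
    · exact Or.inr (Or.inl hDc.symm)
    · exact Or.inr (Or.inr h0.symm)

theorem tauTgt_eq {D : ℕ} (hD : 4 ≤ D) {j : ℕ} (hj1 : 1 ≤ j) (hj2 : j ≤ D + 1)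
    (s : ZMod (D - 2 + 1)) : tauTgt D j s = eSet D (pre (collapse D j) {s}) := by
  have h := isCollapse_collapse hD j
  have hcc := collapse_center hD j
  have hsingle : ∀ k : ZMod (D + 1), s ≠ ((j - 1 : ℕ) : ZMod (D - 2 + 1)) →
      collapse D j k = s → eV D k = eSet D (pre (collapse D j) {s}) := by
    intro k hs hk
    have : pre (collapse D j) {s} = {k} := by
      ext i
      rw [mem_pre, Finset.mem_singleton, Finset.mem_singleton]
      constructor
      · intro hi
        rcases h.fiber i k (hi.trans hk.symm) with h' | h'
        · exact h'
        · exact absurd (hi.symm.trans (h'.trans hcc)) hs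
      · rintro rfl
        exact hk
    rw [this, eSet, Finset.sum_singleton]
  obtain ⟨L, hL1, hLD, hLs, hL⟩ : ∃ L : ℕ, 1 ≤ L ∧ L ≤ D - 1 ∧
      s = (L : ZMod (D - 2 + 1)) ∧ (if s.val = 0 then D - 1 else s.val) = L := by
    refine ⟨_, ?_, ?_, ?_, rfl⟩
    · split_ifs <;> omega
    · have := ZMod.val_lt s
      split_ifs <;> omega
    · split_ifs with h0
      · rw [natCast_add_period (b := 0) (by omega), Nat.cast_zero]
        exact (ZMod.val_eq_zero s).1 h0
      · exact (ZMod.natCast_zmod_val s).symm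
  unfold tauTgt
  simp only [hL]
  split_ifs with h1 h2
  · have : pre (collapse D j) {s} = {(j : ZMod (D + 1)) - 1, (j : ZMod (D + 1)),
        (j : ZMod (D + 1)) + 1} := by
      ext i
      rw [mem_pre, Finset.mem_singleton, h1, ← hcc, Finset.mem_insert, Finset.mem_insert,
        Finset.mem_singleton]
      refine ⟨h.fiber_center i, ?_⟩
      rintro (rfl | rfl | rfl)
      · exact h.pred
      · rfl
      · exact h.succ
    rw [this, eSet, Finset.sum_insert (by
      simpa only [Finset.mem_insert, Finset.mem_singleton, not_or] using
        ⟨h.pred_ne, h.pred_ne_succ⟩), Finset.sum_pair h.succ_ne.symm, add_assoc]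
  · refine hsingle _ h1 ?_
    have hk : (L : ZMod (D + 1)) =
        (j : ZMod (D + 1)) + 1 + ((D + L - j : ℕ) : ZMod (D + 1)) := by
      rw [Nat.cast_sub (by omega), Nat.cast_add, natCast_eq_neg_one]; ring
    rw [hk, collapse_add j (by omega), min_eq_left (by omega), hLs]
    exact natCast_add_period (by omega)
  · refine hsingle _ h1 ?_
    have hLj : L ≠ j - 1 := fun h' => h1 (by rw [hLs, h'])
    have hk : ((L + 2 : ℕ) : ZMod (D + 1)) =
        (j : ZMod (D + 1)) + 1 + ((L + 1 - j : ℕ) : ZMod (D + 1)) := by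
      rw [Nat.cast_sub (by omega)]; push_cast; ring
    rw [hk, collapse_add j (by omega), min_eq_left (by omega), hLs]
    congr 1
    omega

theorem tauMap_eq {D : ℕ} (hD : 4 ≤ D) {j : ℕ} (hj1 : 1 ≤ j) (hj2 : j ≤ D + 1)
    (x : Vsp (D - 2)) : tauMap D j x = pullback (collapse D j) x := by
  have hx : Submodule.Quotient.mk (Quotient.out x) = x := Quotient.out_eq x
  conv_rhs => rw [← hx]
  unfold tauMap
  simp only [tauTgt_eq hD hj1 hj2]
  change _ = Fintype.linearCombination (ZMod 2)
    (fun s => eSet D (pre (collapse D j) {s})) (Quotient.out x)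
  rw [Fintype.linearCombination_apply]

theorem eq_expand {D : ℕ} (hD : 4 ≤ D) (hDev : Even D) {j : ℕ} (hj1 : 1 ≤ j) (hj2 : j ≤ D + 1)
    {C : Finset (Finset (ZMod (D - 2 + 1)))} (hC : phi (D - 2) C)
    {B : Finset (Finset (ZMod (D + 1)))} (hB : phi D B)
    (hspan : (spanB D B : Set (Vsp D)) =
      {x : Vsp D | ∃ y ∈ (spanB (D - 2) C : Set (Vsp (D - 2))), ∃ c : ZMod 2,
        x = tauMap D j y + c • eV D (j : ZMod (D + 1))}) :
    B = expand (collapse D j) (j : ZMod (D + 1)) C := by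
  refine spanB_injOn hDev hB ((isCollapse_collapse hD j).phi_expand hC) (SetLike.coe_injective ?_)
  rw [hspan]
  ext x
  simp only [tauMap_eq hD hj1 hj2]
  exact mem_spanB_expand.symm

/-- Monotonicity of `t_j` (claim in 3.2): if `B₁ < B'₁` in `φ(V_{D−2})` and
`⟨B⟩ = τ_j(⟨B₁⟩) + F₂·e_j`, `⟨B''⟩ = τ_j(⟨B'₁⟩) + F₂·e_j`, then `B < B''` in `φ(V_D)`. -/
theorem tj_monotone (D : ℕ) (hD : 4 ≤ D) (hDev : Even D)
    (j : ℕ) (hj1 : 1 ≤ j) (hj2 : j ≤ D + 1)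
    (B₁ B'₁ : Finset (Finset (ZMod (D - 2 + 1))))
    (hB₁ : phi (D - 2) B₁) (hB'₁ : phi (D - 2) B'₁)
    (hlt : ltφ (D - 2) B₁ B'₁)
    (B B'' : Finset (Finset (ZMod (D + 1)))) (hB : phi D B) (hB'' : phi D B'')
    (hspan : (spanB D B : Set (Vsp D)) =
      {x : Vsp D | ∃ y ∈ (spanB (D - 2) B₁ : Set (Vsp (D - 2))), ∃ c : ZMod 2,
        x = tauMap D j y + c • eV D (j : ZMod (D + 1))})
    (hspan'' : (spanB D B'' : Set (Vsp D)) =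
      {x : Vsp D | ∃ y ∈ (spanB (D - 2) B'₁ : Set (Vsp (D - 2))), ∃ c : ZMod 2,
        x = tauMap D j y + c • eV D (j : ZMod (D + 1))}) :
    ltφ D B B'' := by
  obtain rfl := eq_expand hD hDev hj1 hj2 hB₁ hB hspan
  obtain rfl := eq_expand hD hDev hj1 hj2 hB'₁ hB'' hspan''
  have h := isCollapse_collapse hD j
  exact ⟨h.leφ_expand hlt.1, fun he => hlt.2 (h.expand_injective he)⟩
end

section
/- Triangularity of the Fourier transform in the new basis (3.2(a)): Let n : φ(V_D) × φ(V_D) → ℂ satisfy F(1_{⟨B⟩}) = Σ_{B'∈φ(V_D)} n(B,B')·1_{⟨B'⟩} for every B ∈ φ(V_D). Then: (1) if n(B,B') ≠ 0 and B ≠ B', then B < B' and |B| < |B'|; (2) n(B,B) ∈ {1, −1} for every B ∈ φ(V_D). -/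
open scoped BigOperators

namespace ArcMatching

/-- The arc `{p + 1, …, p + l}`. -/
def arc (D : ℕ) (p : ZMod (D + 1)) (l : ℕ) : Finset (ZMod (D + 1)) :=
  (Finset.range l).image (fun t : ℕ => p + 1 + (t : ZMod (D + 1)))

variable {D : ℕ}

lemma mem_arc {p x : ZMod (D + 1)} {l : ℕ} :
    x ∈ arc D p l ↔ ∃ t : ℕ, 1 ≤ t ∧ t ≤ l ∧ x = p + t := by
  simp only [arc, Finset.mem_image, Finset.mem_range]
  constructor
  · rintro ⟨t, ht, rfl⟩
    exact ⟨t + 1, by omega, by omega, by push_cast; ring⟩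
  · rintro ⟨t, h1, h2, rfl⟩
    obtain ⟨t, rfl⟩ := Nat.exists_eq_add_of_le' h1
    exact ⟨t, by omega, by push_cast; ring⟩

lemma eq_of_add_natCast_eq {a b : ℕ} {p : ZMod (D + 1)} (hab : a < b + (D + 1))
    (hba : b < a + (D + 1)) (h : p + (a : ZMod (D + 1)) = p + b) : a = b := by
  have h' := add_left_cancel h
  wlog hle : a ≤ b generalizing a b
  · exact (this hba hab h.symm h'.symm (by omega)).symm
  have h0 : ((b - a : ℕ) : ZMod (D + 1)) = 0 := by
    rw [Nat.cast_sub hle, h', sub_self]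
  rw [ZMod.natCast_eq_zero_iff] at h0
  have := Nat.eq_zero_of_dvd_of_lt h0 (by omega)
  omega

lemma exists_eq_add_natCast (p x : ZMod (D + 1)) : ∃ u : ℕ, u ≤ D ∧ x = p + u := by
  refine ⟨(x - p).val, Nat.lt_succ_iff.mp (ZMod.val_lt _), ?_⟩
  rw [ZMod.natCast_zmod_val]
  ring

lemma add_mem_arc_add {p : ZMod (D + 1)} {s m t : ℕ} (ht : t ≤ D) (hs : s + m ≤ D) :
    p + (t : ZMod (D + 1)) ∈ arc D (p + s) m ↔ s < t ∧ t ≤ s + m := by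
  rw [mem_arc]
  constructor
  · rintro ⟨u, h1, h2, h⟩
    have h' : p + (t : ZMod (D + 1)) = p + ((s + u : ℕ) : ZMod (D + 1)) := by
      rw [h]; push_cast; ring
    have := eq_of_add_natCast_eq (by omega) (by omega) h'
    omega
  · rintro ⟨h1, h2⟩
    refine ⟨t - s, by omega, by omega, ?_⟩
    rw [Nat.cast_sub h1.le]
    ring

lemma add_mem_arc {p : ZMod (D + 1)} {m t : ℕ} (ht : t ≤ D) (hm : m ≤ D) :
    p + (t : ZMod (D + 1)) ∈ arc D p m ↔ 0 < t ∧ t ≤ m := by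
  simpa using add_mem_arc_add (p := p) (s := 0) ht (by omega : 0 + m ≤ D)

lemma self_notMem_arc {p : ZMod (D + 1)} {l : ℕ} (hl : l ≤ D) : p ∉ arc D p l := by
  simpa using add_mem_arc (p := p) (t := 0) (by omega) hl

lemma add_one_mem_arc {p : ZMod (D + 1)} {l : ℕ} (hl : 1 ≤ l) : p + 1 ∈ arc D p l :=
  mem_arc.2 ⟨1, le_rfl, hl, by simp⟩

lemma eq_of_notMem_of_add_one_mem {p x : ZMod (D + 1)} {l : ℕ} (h : x ∉ arc D p l)
    (h' : x + 1 ∈ arc D p l) : x = p := by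
  obtain ⟨t, h1, h2, ht⟩ := mem_arc.1 h'
  obtain ⟨t, rfl⟩ := Nat.exists_eq_add_of_le' h1
  have hx : x = p + t := by
    apply add_right_cancel (b := 1)
    rw [ht]; push_cast; ring
  rcases Nat.eq_zero_or_pos t with rfl | h0
  · simpa using hx
  · exact absurd (mem_arc.2 ⟨t, h0, by omega, hx⟩) h

lemma card_arc {p : ZMod (D + 1)} {l : ℕ} (hl : l ≤ D + 1) : (arc D p l).card = l := by
  rw [arc, Finset.card_image_of_injOn, Finset.card_range]
  intro a ha b hb h
  simp only [Finset.coe_range, Set.mem_Iio] at ha hb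
  exact eq_of_add_natCast_eq (by omega) (by omega) h

lemma arc_inj {p q : ZMod (D + 1)} {l m : ℕ} (hl : 1 ≤ l) (hl' : l ≤ D) (hm : m ≤ D)
    (h : arc D p l = arc D q m) : p = q ∧ l = m := by
  refine ⟨?_, ?_⟩
  · apply eq_of_notMem_of_add_one_mem (l := m)
    · rw [← h]; exact self_notMem_arc hl'
    · rw [← h]; exact add_one_mem_arc hl
  · rw [← card_arc (p := p) (l := l) (by omega), h, card_arc (by omega)]

lemma exists_of_arc_subset {p q : ZMod (D + 1)} {l m : ℕ} (hm : 1 ≤ m) (hl : l ≤ D)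
    (h : arc D q m ⊆ arc D p l) : ∃ s : ℕ, q = p + s ∧ s + m ≤ l := by
  obtain ⟨t, h1, h2, ht⟩ := mem_arc.1 (h (add_one_mem_arc hm))
  obtain ⟨s, rfl⟩ := Nat.exists_eq_add_of_le' h1
  have hq : q = p + s := by
    apply add_right_cancel (b := 1)
    rw [ht]; push_cast; ring
  refine ⟨s, hq, ?_⟩
  by_contra hlt
  have hx : q + ((l + 1 - s : ℕ) : ZMod (D + 1)) ∈ arc D q m :=
    mem_arc.2 ⟨l + 1 - s, by omega, by omega, rfl⟩
  obtain ⟨u, hu1, hu2, hu⟩ := mem_arc.1 (h hx)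
  have : p + ((l + 1 : ℕ) : ZMod (D + 1)) = p + u := by
    rw [← hu, hq, Nat.cast_sub (by omega)]; ring
  have := eq_of_add_natCast_eq (by omega) (by omega) this
  omega

lemma isInterval_iff {I : Finset (ZMod (D + 1))} :
    IsInterval D I ↔ ∃ p l, 1 ≤ l ∧ l ≤ D ∧ I = arc D p l := by
  constructor
  · rintro ⟨i, l, h1, h2, rfl⟩
    exact ⟨i - 1, l, h1, h2, by simp [arc]⟩
  · rintro ⟨p, l, h1, h2, rfl⟩
    exact ⟨p + 1, l, h1, h2, rfl⟩

lemma oddInterval_arc {p : ZMod (D + 1)} {l : ℕ} (hl : Odd l) (h : l ≤ D) :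
    OddInterval D (arc D p l) :=
  ⟨isInterval_iff.2 ⟨p, l, hl.pos, h, rfl⟩, by rwa [card_arc (by omega)]⟩

lemma exists_arc_of_oddInterval {I : Finset (ZMod (D + 1))} (h : OddInterval D I) :
    ∃ p l, Odd l ∧ l ≤ D ∧ I = arc D p l := by
  obtain ⟨p, l, -, h2, rfl⟩ := isInterval_iff.1 h.1
  exact ⟨p, l, by simpa [card_arc (show l ≤ D + 1 by omega)] using h.2, h2, rfl⟩

lemma not_isInterval_union {p q : ZMod (D + 1)} {l m : ℕ} (hl : 1 ≤ l) (hl' : l ≤ D)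
    (hm : 1 ≤ m) (hm' : m ≤ D) (hpq : p ≠ q) (hp : p ∉ arc D q m) (hq : q ∉ arc D p l) :
    ¬ IsInterval D (arc D p l ∪ arc D q m) := by
  intro h
  obtain ⟨r, k, -, -, h⟩ := isInterval_iff.1 h
  have h1 : p = r := by
    apply eq_of_notMem_of_add_one_mem (l := k)
    · rw [← h, Finset.mem_union]
      exact not_or.2 ⟨self_notMem_arc hl', hp⟩
    · rw [← h, Finset.mem_union]
      exact Or.inl (add_one_mem_arc hl)
  have h2 : q = r := by
    apply eq_of_notMem_of_add_one_mem (l := k)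
    · rw [← h, Finset.mem_union]
      exact not_or.2 ⟨hq, self_notMem_arc hm'⟩
    · rw [← h, Finset.mem_union]
      exact Or.inr (add_one_mem_arc hm)
  exact hpq (h1.trans h2.symm)

lemma arc_union_arc (p : ZMod (D + 1)) (l m : ℕ) :
    arc D p l ∪ arc D (p + l) m = arc D p (l + m) := by
  ext x
  simp only [Finset.mem_union, mem_arc]
  constructor
  · rintro (⟨t, h1, h2, rfl⟩ | ⟨t, h1, h2, rfl⟩)
    · exact ⟨t, h1, by omega, rfl⟩
    · exact ⟨l + t, by omega, by omega, by push_cast; ring⟩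
  · rintro ⟨t, h1, h2, rfl⟩
    rcases le_or_gt t l with h | h
    · exact Or.inl ⟨t, h1, h, rfl⟩
    · exact Or.inr ⟨t - l, by omega, by omega, by rw [Nat.cast_sub h.le]; ring⟩

lemma arc_erase {p : ZMod (D + 1)} {l t : ℕ} (hl : l ≤ D) (ht : 0 < t) (htl : t ≤ l) :
    (arc D p l).erase (p + t) = arc D p (t - 1) ∪ arc D (p + t) (l - t) := by
  ext x
  obtain ⟨u, hu, rfl⟩ := exists_eq_add_natCast p x
  rw [Finset.mem_erase, Finset.mem_union, add_mem_arc hu hl, add_mem_arc hu (by omega),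
    add_mem_arc_add hu (by omega)]
  have : p + (u : ZMod (D + 1)) ≠ p + t ↔ u ≠ t :=
    ⟨fun h h' => h (by rw [h']), fun h h' => h (eq_of_add_natCast_eq (by omega) (by omega) h')⟩
  rw [this]
  omega

lemma mem_evSet_arc {p : ZMod (D + 1)} {l t : ℕ} (hl : Odd l) (hlD : l ≤ D) (ht : Even t)
    (h0 : 0 < t) (htl : t < l) : p + (t : ZMod (D + 1)) ∈ evSet D (arc D p l) := by
  have hpt : p ≠ p + (t : ZMod (D + 1)) := fun h => by
    have : p + ((0 : ℕ) : ZMod (D + 1)) = p + t := by simpa using h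
    have := eq_of_add_natCast_eq (by omega) (by omega) this
    omega
  have h1 : Odd (t - 1) := by grind
  have h2 : Odd (l - t) := by grind
  refine (@Finset.mem_filter _ _ (Classical.decPred _) _ _).2
    ⟨(add_mem_arc (by omega) hlD).2 ⟨h0, htl.le⟩, arc D p (t - 1), arc D (p + t) (l - t),
    oddInterval_arc h1 (by omega), oddInterval_arc h2 (by omega), ⟨?_, ?_⟩,
    arc_erase hlD h0 htl.le⟩
  · ext x
    obtain ⟨u, hu, rfl⟩ := exists_eq_add_natCast p x
    rw [Finset.mem_inter, add_mem_arc hu (by omega), add_mem_arc_add hu (by omega)]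
    simp only [Finset.notMem_empty, iff_false]
    omega
  · apply not_isInterval_union h1.pos (by omega) h2.pos (by omega) hpt
    · have := add_mem_arc_add (p := p) (t := 0) (s := t) (m := l - t) (by omega) (by omega)
      simpa using this
    · rw [add_mem_arc (by omega) (by omega)]
      omega

/-- The arc `{p + 1, …, p + l}` has odd length and belongs to `B`. -/
def HasArc (B : Finset (Finset (ZMod (D + 1)))) (p : ZMod (D + 1)) (l : ℕ) : Prop :=
  Odd l ∧ l ≤ D ∧ arc D p l ∈ B

/-- `r` is one of the two ends `p`, `p + l` of an arc `{p + 1, …, p + l}` in `B`. -/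
def IsMatched (B : Finset (Finset (ZMod (D + 1)))) (r : ZMod (D + 1)) : Prop :=
  ∃ p l, HasArc B p l ∧ (r = p ∨ r = p + l)

/-- `B` is a noncrossing partial matching of the cyclically ordered set `ZMod (D + 1)` (an arc
`{p + 1, …, p + l}` joining `p` to `p + l`) with no unmatched point below an arc. -/
structure IsMatching (B : Finset (Finset (ZMod (D + 1)))) : Prop where
  odd : ∀ I ∈ B, OddInterval D I
  ends : ∀ {p l q m}, HasArc B p l → HasArc B q m →
    (p = q ∨ p = q + m ∨ p + (l : ZMod (D + 1)) = q + m) → p = q ∧ l = m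
  inner : ∀ {p l}, HasArc B p l → ∀ t, 0 < t → t < l →
    ∃ s k : ℕ, HasArc B (p + s) k ∧ 0 < s ∧ s + k < l ∧ (t = s ∨ t = s + k)

section phi

variable {B : Finset (Finset (ZMod (D + 1)))} {p q : ZMod (D + 1)} {l m : ℕ}

lemma phi_laminar (hB : phi D B) (h : HasArc B p l) (h' : HasArc B q m) {x : ZMod (D + 1)}
    (hx : x ∈ arc D p l) (hx' : x ∈ arc D q m) :
    arc D p l ⊆ arc D q m ∨ arc D q m ⊆ arc D p l := by
  rcases hB.2.1 _ h.2.2 _ h'.2.2 with h | h | h | h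
  · exact Or.inl h.subset
  · exact absurd (Finset.mem_inter.2 ⟨hx, hx'⟩) (by simp [h.1])
  · exact Or.inl h.1.subset
  · exact Or.inr h.1.subset

lemma phi_not_adjacent (hD : Even D) (hB : phi D B) (h : HasArc B p l)
    (h' : HasArc B (p + l) m) : False := by
  have hl := h.1.pos
  have hlD := h.2.1
  have hmD := h'.2.1
  have e1 : p + (l : ZMod (D + 1)) ∈ arc D p l := (add_mem_arc hlD hlD).2 ⟨hl, le_rfl⟩
  have e2 : p + (l : ZMod (D + 1)) ∉ arc D (p + l) m := self_notMem_arc hmD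
  have e3 : p + (l : ZMod (D + 1)) + 1 ∈ arc D (p + l) m := add_one_mem_arc h'.1.pos
  have e4 : p + (l : ZMod (D + 1)) + 1 ∉ arc D p l := by
    intro hx
    obtain ⟨t, ht1, ht2, ht⟩ := mem_arc.1 hx
    have : p + ((l + 1 : ℕ) : ZMod (D + 1)) = p + t := by rw [← ht]; push_cast; ring
    have := eq_of_add_natCast_eq (by omega) (by omega) this
    omega
  rcases hB.2.1 _ h.2.2 _ h'.2.2 with h1 | h1 | h1 | h1
  · exact e2 (h1 ▸ e1)
  · obtain ⟨h1, h2⟩ := h1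
    rw [arc_union_arc] at h2
    have hlm : Even (l + m) := h.1.add_odd h'.1
    rcases le_or_gt (l + m) D with hle | hgt
    · exact h2 (isInterval_iff.2 ⟨p, l + m, by omega, hle, rfl⟩)
    · have hx : p + 1 ∈ arc D (p + l) m := by
        refine mem_arc.2 ⟨D + 2 - l, by omega, by grind, ?_⟩
        rw [Nat.cast_sub (by omega)]
        have : ((D + 1 : ℕ) : ZMod (D + 1)) = 0 := ZMod.natCast_self _
        push_cast at this ⊢
        linear_combination -this
      have := Finset.mem_inter.2 ⟨add_one_mem_arc hl, hx⟩
      simp [h1] at this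
  · exact e2 (h1.1.subset e1)
  · exact e4 (h1.1.subset e3)

lemma phi_even_covered (hD : Even D) (hB : phi D B) (h : HasArc B p l) {t : ℕ} (ht : Even t)
    (h0 : 0 < t) (htl : t < l) :
    ∃ s k : ℕ, HasArc B (p + s) k ∧ Odd s ∧ s < t ∧ t ≤ s + k ∧ s + k < l := by
  have hlD := h.2.1
  obtain ⟨𝒥, hsub, hprec, hdisj, hcov⟩ := hB.2.2 _ h.2.2
  have child : ∀ t : ℕ, Even t → 0 < t → t < l → ∃ s k : ℕ, HasArc B (p + s) k ∧
      arc D (p + s) k ∈ 𝒥 ∧ s < t ∧ t ≤ s + k ∧ s + k ≤ l ∧ k < l := by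
    intro t ht h0 htl
    obtain ⟨J, hJ, hx⟩ := Finset.mem_biUnion.1 (hcov (mem_evSet_arc h.1 hlD ht h0 htl))
    obtain ⟨q, k, hk, hkD, rfl⟩ := exists_arc_of_oddInterval (hB.1 J (hsub hJ))
    obtain ⟨s, rfl, hs⟩ := exists_of_arc_subset hk.pos hlD (hprec _ hJ).1.subset
    have := (add_mem_arc_add (by omega) (by omega)).1 hx
    have hlt := Finset.card_lt_card (hprec _ hJ).1
    rw [card_arc (by omega), card_arc (by omega)] at hlt
    exact ⟨s, k, ⟨hk, hkD, hsub hJ⟩, hJ, this.1, this.2, hs, hlt⟩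
  obtain ⟨s, k, hk, hJ, h1, h2, h3, h4⟩ := child t ht h0 htl
  have hsD : s + k ≤ D := by omega
  have hso : Odd s := by
    by_contra he
    rw [Nat.not_odd_iff_even] at he
    have hkpos := hk.1.pos
    rcases Nat.eq_zero_or_pos s with hs | hs
    · have hk1 := hk.1
      have hsk : Even (s + k + 1) := by grind
      obtain ⟨s', k', hk', hJ', h1', h2', h3', -⟩ :=
        child (s + k + 1) hsk (by omega) (by have := h.1; grind)
      have hne : arc D (p + s) k ≠ arc D (p + s') k' := fun heq => by
        have hx : p + ((s + k + 1 : ℕ) : ZMod (D + 1)) ∈ arc D (p + s') k' :=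
          (add_mem_arc_add (by omega) (by omega)).2 ⟨h1', h2'⟩
        rw [← heq, add_mem_arc_add (by omega) (by omega)] at hx
        omega
      have hdis : p + ((s + k : ℕ) : ZMod (D + 1)) ∉ arc D (p + s') k' :=
        Finset.disjoint_left.1 (hdisj _ hJ _ hJ' hne)
          ((add_mem_arc_add (by omega) (by omega)).2 ⟨by omega, by omega⟩)
      rw [add_mem_arc_add (by omega) (by omega)] at hdis
      have hs' : s' = s + k := by omega
      subst hs'
      apply phi_not_adjacent hD hB hk (m := k')
      convert hk' using 1
      push_cast; ring
    · obtain ⟨s', k', hk', hJ', h1', h2', h3', -⟩ := child s he hs (by omega)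
      have hne : arc D (p + s) k ≠ arc D (p + s') k' := fun heq => by
        have hx : p + (s : ZMod (D + 1)) ∈ arc D (p + s') k' :=
          (add_mem_arc_add (by omega) (by omega)).2 ⟨h1', h2'⟩
        rw [← heq] at hx
        exact self_notMem_arc (by omega) hx
      have hdis : p + ((s + 1 : ℕ) : ZMod (D + 1)) ∉ arc D (p + s') k' :=
        Finset.disjoint_left.1 (hdisj _ hJ _ hJ' hne)
          ((add_mem_arc_add (by omega) (by omega)).2 ⟨by omega, by omega⟩)
      rw [add_mem_arc_add (by omega) (by omega)] at hdis
      have hs' : s = s' + k' := by omega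
      subst hs'
      apply phi_not_adjacent hD hB hk' (m := k)
      convert hk using 1
      push_cast; ring
  refine ⟨s, k, hk, hso, h1, h2, ?_⟩
  have := hk.1
  have := h.1
  grind

lemma phi_left_unique (hD : Even D) (hB : phi D B) (h : HasArc B p l) (h' : HasArc B p m) :
    ¬ m < l := by
  intro hml
  have hl := h.1
  have hm := h'.1
  have hlD := h.2.1
  obtain ⟨s, k, hk, hs, h1, h2, h3⟩ := phi_even_covered hD hB h (t := m + 1) (by grind)
    (by omega) (by grind)
  rcases eq_or_lt_of_le (Nat.lt_succ_iff.1 h1) with rfl | hsm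
  · exact phi_not_adjacent hD hB h' hk
  · rcases phi_laminar hB h' hk (x := p + ((s + 1 : ℕ) : ZMod (D + 1)))
      ((add_mem_arc (by omega) (by omega)).2 (by omega))
      ((add_mem_arc_add (by omega) (by omega)).2 (by omega)) with hsub | hsub
    · have := hsub ((add_mem_arc (t := 1) (by omega) (by omega)).2 (by omega))
      rw [add_mem_arc_add (by omega) (by omega)] at this
      grind
    · have := hsub ((add_mem_arc_add (t := m + 1) (by omega) (by omega)).2 ⟨h1, h2⟩)
      rw [add_mem_arc (by omega) (by omega)] at this
      omega

lemma phi_right_unique (hD : Even D) (hB : phi D B) {s : ℕ} (h : HasArc B p l)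
    (h' : HasArc B (p + s) m) (hs : 0 < s) : s + m ≠ l := by
  intro hsl
  have hl := h.1
  have hm := h'.1
  have hlD := h.2.1
  have hmp := hm.pos
  obtain ⟨a, k, hk, ha, h1, h2, h3⟩ := phi_even_covered hD hB h (t := s) (by grind) hs (by omega)
  rcases eq_or_lt_of_le h2 with rfl | hlt
  · apply phi_not_adjacent hD hB hk (m := m)
    convert h' using 1
    push_cast; ring
  · rcases phi_laminar hB h' hk (x := p + ((s + 1 : ℕ) : ZMod (D + 1)))
      ((add_mem_arc_add (by omega) (by omega)).2 (by omega))
      ((add_mem_arc_add (by omega) (by omega)).2 (by omega)) with hsub | hsub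
    · have := hsub ((add_mem_arc_add (t := s + m) (by omega) (by omega)).2 (by omega))
      rw [add_mem_arc_add (by omega) (by omega)] at this
      omega
    · have := hsub ((add_mem_arc_add (t := s) (by omega) (by omega)).2 ⟨h1, h2⟩)
      rw [add_mem_arc_add (by omega) (by omega)] at this
      omega

lemma phi_inner (hD : Even D) (hB : phi D B) (h : HasArc B p l) (t : ℕ) (h0 : 0 < t)
    (htl : t < l) :
    ∃ s k : ℕ, HasArc B (p + s) k ∧ 0 < s ∧ s + k < l ∧ (t = s ∨ t = s + k) := by
  induction l using Nat.strong_induction_on generalizing p t with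
  | _ l ih =>
    have key : ∀ s k : ℕ, HasArc B (p + s) k → s < t → t < s + k → s + k < l →
        ∃ s k : ℕ, HasArc B (p + s) k ∧ 0 < s ∧ s + k < l ∧ (t = s ∨ t = s + k) := by
      intro s k hk h1 h2 h3
      obtain ⟨s', k', hk', h4, h5, h6⟩ := ih k (by omega) hk (t - s) (by omega) (by omega)
      refine ⟨s + s', k', ?_, by omega, by omega, by omega⟩
      convert hk' using 1
      push_cast; ring
    rcases Nat.even_or_odd t with ht | ht
    · obtain ⟨s, k, hk, hs, h1, h2, h3⟩ := phi_even_covered hD hB h ht h0 htl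
      rcases eq_or_lt_of_le h2 with h4 | h4
      · exact ⟨s, k, hk, hs.pos, h3, Or.inr h4⟩
      · exact key s k hk h1 h4 h3
    · obtain ⟨s, k, hk, hs, h1, h2, h3⟩ := phi_even_covered hD hB h (t := t + 1) (by grind)
        (by omega) (by have := h.1; grind)
      rcases eq_or_lt_of_le (Nat.lt_succ_iff.1 h1) with h4 | h4
      · exact ⟨s, k, hk, hs.pos, h3, Or.inl h4.symm⟩
      · exact key s k hk h4 (by omega) h3

theorem isMatching_of_phi (hD : Even D) (hB : phi D B) : IsMatching B where
  odd := hB.1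
  ends := by
    intro p l q m h h' hpq
    rcases hpq with rfl | rfl | hpq
    · have h1 := phi_left_unique hD hB h h'
      have h2 := phi_left_unique hD hB h' h
      exact ⟨rfl, by omega⟩
    · exact (phi_not_adjacent hD hB h' h).elim
    · rcases lt_trichotomy l m with hlt | rfl | hlt
      · refine absurd ?_ (phi_right_unique hD hB (s := m - l) (m := l) h' ?_ (by omega))
        · omega
        · convert h using 1
          rw [Nat.cast_sub hlt.le]
          linear_combination -hpq
      · exact ⟨add_right_cancel hpq, rfl⟩
      · refine absurd ?_ (phi_right_unique hD hB (s := l - m) (m := m) h ?_ (by omega))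
        · omega
        · convert h' using 1
          rw [Nat.cast_sub hlt.le]
          linear_combination hpq
  inner := fun h => phi_inner hD hB h

end phi

namespace IsMatching

variable {B : Finset (Finset (ZMod (D + 1)))} {p q : ZMod (D + 1)} {l m : ℕ}

lemma add_ne_self (h : HasArc B p l) : p + (l : ZMod (D + 1)) ≠ p := fun hp => by
  have h1 := h.1.pos
  have h2 := h.2.1
  have : p + (l : ZMod (D + 1)) = p + ((0 : ℕ) : ZMod (D + 1)) := by simpa using hp
  have := eq_of_add_natCast_eq (by omega) (by omega) this
  omega

lemma inside (hB : IsMatching B) (h : HasArc B p l) {t : ℕ} (h0 : 0 < t) (htl : t < l)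
    (h' : HasArc B q m) (ht : p + (t : ZMod (D + 1)) = q ∨ p + (t : ZMod (D + 1)) = q + m) :
    ∃ s : ℕ, q = p + s ∧ 0 < s ∧ s + m < l ∧ (t = s ∨ t = s + m) := by
  obtain ⟨s, k, hk, h1, h2, h3⟩ := hB.inner h t h0 htl
  have : p + (s : ZMod (D + 1)) = q ∧ k = m := by
    rcases h3 with rfl | rfl <;> rcases ht with ht | ht
    · exact hB.ends hk h' (Or.inl ht)
    · exact hB.ends hk h' (Or.inr (Or.inl ht))
    · have := hB.ends h' hk (Or.inr (Or.inl (by rw [← ht]; push_cast; ring)))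
      exact ⟨this.1.symm, this.2.symm⟩
    · exact hB.ends hk h' (Or.inr (Or.inr (by rw [← ht]; push_cast; ring)))
  obtain ⟨rfl, rfl⟩ := this
  exact ⟨s, rfl, h1, h2, h3⟩

lemma isMatched_of_inner (hB : IsMatching B) (h : HasArc B p l) {t : ℕ} (htl : t ≤ l) :
    IsMatched B (p + t) := by
  rcases Nat.eq_zero_or_pos t with rfl | h0
  · exact ⟨p, l, h, Or.inl (by simp)⟩
  rcases eq_or_lt_of_le htl with rfl | hlt
  · exact ⟨p, t, h, Or.inr rfl⟩
  obtain ⟨s, k, hk, -, -, h3⟩ := hB.inner h t h0 hlt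
  refine ⟨_, k, hk, ?_⟩
  rcases h3 with rfl | rfl
  · exact Or.inl rfl
  · exact Or.inr (by push_cast; ring)

/-- A function which agrees at the two ends of each arc, and vanishes elsewhere, has sum zero. -/
lemma sum_eq_zero (hB : IsMatching B) (f : ZMod (D + 1) → ZMod 2)
    (hf : ∀ q m, HasArc B q m → f q = f (q + m)) (h0 : ∀ r, ¬ IsMatched B r → f r = 0) :
    ∑ r, f r = 0 := by
  have hex : ∀ r, ∃ r', (∃ q m, HasArc B q m ∧ (r = q ∧ r' = q + m ∨ r = q + m ∧ r' = q)) ∨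
      (¬ IsMatched B r ∧ r' = r) := by
    intro r
    by_cases hr : IsMatched B r
    · obtain ⟨q, m, h, rfl | rfl⟩ := hr
      · exact ⟨_, Or.inl ⟨_, _, h, Or.inl ⟨rfl, rfl⟩⟩⟩
      · exact ⟨_, Or.inl ⟨_, _, h, Or.inr ⟨rfl, rfl⟩⟩⟩
    · exact ⟨r, Or.inr ⟨hr, rfl⟩⟩
  choose g hg using hex
  have hleft : ∀ {q m}, HasArc B q m → g q = q + m := by
    intro q m h
    rcases hg q with ⟨q', m', h', ⟨h1, h2⟩ | ⟨h1, h2⟩⟩ | ⟨h1, -⟩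
    · obtain ⟨rfl, rfl⟩ := hB.ends h h' (Or.inl h1)
      exact h2
    · obtain ⟨rfl, rfl⟩ := hB.ends h h' (Or.inr (Or.inl h1))
      exact absurd h1.symm (add_ne_self h)
    · exact absurd ⟨q, m, h, Or.inl rfl⟩ h1
  have hright : ∀ {q m}, HasArc B q m → g (q + m) = q := by
    intro q m h
    rcases hg (q + m) with ⟨q', m', h', ⟨h1, h2⟩ | ⟨h1, h2⟩⟩ | ⟨h1, -⟩
    · obtain ⟨rfl, rfl⟩ := hB.ends h' h (Or.inr (Or.inl h1.symm))
      exact absurd h1 (add_ne_self h)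
    · obtain ⟨rfl, rfl⟩ := hB.ends h h' (Or.inr (Or.inr h1))
      exact h2
    · exact absurd ⟨q, m, h, Or.inr rfl⟩ h1
  refine Finset.sum_involution (fun r _ => g r) ?_ ?_ (fun _ _ => Finset.mem_univ _) ?_
  · intro r _
    by_cases hr : IsMatched B r
    · obtain ⟨q, m, h, rfl | rfl⟩ := hr
      · rw [hleft h, ← hf _ _ h]; exact CharTwo.add_self_eq_zero _
      · rw [hright h, ← hf _ _ h]; exact CharTwo.add_self_eq_zero _
    · rcases hg r with ⟨q', m', h', ⟨h1, h2⟩ | ⟨h1, h2⟩⟩ | ⟨h1, h2⟩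
      · exact absurd ⟨_, _, h', Or.inl h1⟩ hr
      · exact absurd ⟨_, _, h', Or.inr h1⟩ hr
      · rw [h2, h0 r hr, add_zero]
  · intro r _ hne
    by_cases hr : IsMatched B r
    · obtain ⟨q, m, h, rfl | rfl⟩ := hr
      · rw [hleft h]; exact add_ne_self h
      · rw [hright h]; exact (add_ne_self h).symm
    · exact absurd (h0 r hr) hne
  · intro r _
    by_cases hr : IsMatched B r
    · obtain ⟨q, m, h, rfl | rfl⟩ := hr
      · rw [hleft h, hright h]
      · rw [hright h, hleft h]
    · rcases hg r with ⟨q', m', h', ⟨h1, h2⟩ | ⟨h1, h2⟩⟩ | ⟨h1, h2⟩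
      · exact absurd ⟨_, _, h', Or.inl h1⟩ hr
      · exact absurd ⟨_, _, h', Or.inr h1⟩ hr
      · rw [h2, h2]

/-- A stretch of points matched among themselves has even length. -/
lemma odd_of_closed (hB : IsMatching B) {n : ℕ} (hn : 1 ≤ n) (hnD : n ≤ D + 1)
    (h : ∀ t, 0 < t → t < n →
      ∃ s k : ℕ, HasArc B (p + s) k ∧ 0 < s ∧ s + k < n ∧ (t = s ∨ t = s + k)) : Odd n := by
  classical
  have hmem : ∀ {q m}, HasArc B q m → (q ∈ arc D p (n - 1) ↔ q + m ∈ arc D p (n - 1)) := by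
    intro q m hq
    constructor
    · intro hx
      obtain ⟨t, h1, h2, rfl⟩ := mem_arc.1 hx
      obtain ⟨s, k, hk, h3, h4, h5⟩ := h t (by omega) (by omega)
      have : p + (s : ZMod (D + 1)) = p + (t : ZMod (D + 1)) ∧ k = m := by
        rcases h5 with rfl | rfl
        · exact hB.ends hk hq (Or.inl rfl)
        · have := hB.ends hq hk (Or.inr (Or.inl (by push_cast; ring)))
          exact ⟨this.1.symm, this.2.symm⟩
      obtain ⟨h6, rfl⟩ := this
      rw [← h6]
      exact mem_arc.2 ⟨s + k, by omega, by omega, by push_cast; ring⟩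
    · intro hx
      obtain ⟨t, h1, h2, h6⟩ := mem_arc.1 hx
      obtain ⟨s, k, hk, h3, h4, h5⟩ := h t (by omega) (by omega)
      have : p + (s : ZMod (D + 1)) = q ∧ k = m := by
        rcases h5 with rfl | rfl
        · exact hB.ends hk hq (Or.inr (Or.inl h6.symm))
        · exact hB.ends hk hq (Or.inr (Or.inr (by rw [h6]; push_cast; ring)))
      rw [← this.1]
      exact mem_arc.2 ⟨s, by omega, by omega, rfl⟩
  have hsum := hB.sum_eq_zero (fun r => if r ∈ arc D p (n - 1) then 1 else 0)
    (fun q m hq => by simp only [hmem hq]) (fun r hr => by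
      rw [if_neg]
      intro hx
      obtain ⟨t, h1, h2, rfl⟩ := mem_arc.1 hx
      obtain ⟨s, k, hk, h3, h4, h5⟩ := h t (by omega) (by omega)
      refine hr ⟨_, k, hk, ?_⟩
      rcases h5 with rfl | rfl
      · exact Or.inl rfl
      · exact Or.inr (by push_cast; ring))
  rw [Finset.sum_ite_mem, Finset.univ_inter, Finset.sum_const, nsmul_one,
    card_arc (by omega), ZMod.natCast_eq_zero_iff_even] at hsum
  grind

lemma hasArc_insert {a : ZMod (D + 1)} {s : ℕ} (hs : Odd s) (hsD : s ≤ D) :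
    HasArc (insert (arc D a s) B) p l ↔ HasArc B p l ∨ (p = a ∧ l = s) := by
  unfold HasArc
  rw [Finset.mem_insert]
  constructor
  · rintro ⟨h1, h2, h3 | h3⟩
    · exact Or.inr (arc_inj h1.pos h2 hsD h3)
    · exact Or.inl ⟨h1, h2, h3⟩
  · rintro (⟨h1, h2, h3⟩ | ⟨rfl, rfl⟩)
    · exact ⟨h1, h2, Or.inr h3⟩
    · exact ⟨hs, hsD, Or.inl rfl⟩

/-- An unmatched point can be joined to the next unmatched point. -/
theorem exists_insert (hB : IsMatching B) {a : ZMod (D + 1)} {g : ℕ} (ha : ¬ IsMatched B a)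
    (hg : ¬ IsMatched B (a + g)) (hg1 : 1 ≤ g) (hgD : g ≤ D) :
    ∃ s : ℕ, 1 ≤ s ∧ s ≤ g ∧ ¬ IsMatched B (a + s) ∧ Odd s ∧
      IsMatching (insert (arc D a s) B) := by
  classical
  have hex : ∃ s : ℕ, 1 ≤ s ∧ ¬ IsMatched B (a + s) := ⟨g, hg1, hg⟩
  obtain ⟨s, ⟨hs1, hs⟩, hmin, hsg⟩ : ∃ s : ℕ, (1 ≤ s ∧ ¬ IsMatched B (a + s)) ∧
      (∀ t : ℕ, 0 < t → t < s → IsMatched B (a + t)) ∧ s ≤ g :=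
    ⟨Nat.find hex, Nat.find_spec hex, fun t h0 hlt => by
      have := Nat.find_min hex hlt
      by_contra hcon
      exact this ⟨h0, hcon⟩, Nat.find_min' hex ⟨hg1, hg⟩⟩
  have hclosed : ∀ t, 0 < t → t < s →
      ∃ u k : ℕ, HasArc B (a + u) k ∧ 0 < u ∧ u + k < s ∧ (t = u ∨ t = u + k) := by
    intro t h0 hts
    obtain ⟨q, m, hq, rfl | hqt⟩ := hmin t h0 hts
    · refine ⟨t, m, hq, h0, ?_, Or.inl rfl⟩
      by_contra hcon
      refine hs ?_
      have := hB.isMatched_of_inner hq (t := s - t) (by omega)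
      rwa [Nat.cast_sub hts.le, add_assoc, add_sub_cancel] at this
    · rcases lt_or_ge m t with hmt | hmt
      · have hqa : q = a + ((t - m : ℕ) : ZMod (D + 1)) := by
          rw [Nat.cast_sub hmt.le]
          linear_combination -hqt
        subst hqa
        exact ⟨t - m, m, hq, by omega, by omega, Or.inr (by omega)⟩
      · refine absurd ?_ ha
        have := hB.isMatched_of_inner hq (t := m - t) (by omega)
        convert this using 1
        rw [Nat.cast_sub hmt]
        linear_combination hqt
  have hodd : Odd s := hB.odd_of_closed hs1 (by omega) hclosed
  have hsD : s ≤ D := by omega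
  refine ⟨s, hs1, hsg, hs, hodd, ?_, ?_, ?_⟩
  · intro I hI
    rcases Finset.mem_insert.1 hI with rfl | hI
    · exact oddInterval_arc hodd hsD
    · exact hB.odd I hI
  · intro p l q m h h' hpq
    rw [hasArc_insert hodd hsD] at h h'
    rcases h with h | ⟨rfl, rfl⟩ <;> rcases h' with h' | ⟨rfl, rfl⟩
    · exact hB.ends h h' hpq
    · exfalso
      rcases hpq with rfl | rfl | hpq
      · exact ha ⟨_, _, h, Or.inl rfl⟩
      · exact hs ⟨_, _, h, Or.inl rfl⟩
      · exact hs ⟨_, _, h, Or.inr hpq.symm⟩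
    · exfalso
      rcases hpq with rfl | rfl | hpq
      · exact ha ⟨_, _, h', Or.inl rfl⟩
      · exact ha ⟨_, _, h', Or.inr rfl⟩
      · exact hs ⟨_, _, h', Or.inr hpq⟩
    · rcases hpq with hpq | hpq | hpq
      · exact ⟨rfl, rfl⟩
      · exact ⟨rfl, rfl⟩
      · exact ⟨rfl, rfl⟩
  · intro p l h t h0 htl
    rw [hasArc_insert hodd hsD] at h
    rcases h with h | ⟨rfl, rfl⟩
    · obtain ⟨u, k, hk, h1⟩ := hB.inner h t h0 htl
      exact ⟨u, k, (hasArc_insert hodd hsD).2 (Or.inl hk), h1⟩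
    · obtain ⟨u, k, hk, h1⟩ := hclosed t h0 htl
      exact ⟨u, k, (hasArc_insert hodd hsD).2 (Or.inl hk), h1⟩

lemma laminar (hB : IsMatching B) (h : HasArc B p l) (h' : HasArc B q m) :
    (p = q ∧ l = m) ∨ (∃ s : ℕ, q = p + s ∧ 0 < s ∧ s + m < l) ∨
      (∃ s : ℕ, p = q + s ∧ 0 < s ∧ s + l < m) ∨
      (Disjoint (arc D p l) (arc D q m) ∧ p ≠ q ∧ p ∉ arc D q m ∧ q ∉ arc D p l) := by
  have aux : ∀ {p q : ZMod (D + 1)} {l m : ℕ}, HasArc B p l → HasArc B q m →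
      q ∈ arc D p l → ∃ s : ℕ, q = p + s ∧ 0 < s ∧ s + m < l := by
    intro p q l m h h' hx
    obtain ⟨t, h1, h2, rfl⟩ := mem_arc.1 hx
    rcases eq_or_lt_of_le h2 with rfl | hlt
    · have := (hB.ends h' h (Or.inr (Or.inl rfl))).1
      exact absurd this (add_ne_self h)
    · obtain ⟨s, h3, h4, h5, -⟩ := hB.inside h h1 hlt h' (Or.inl rfl)
      exact ⟨s, h3, h4, h5⟩
  by_cases hpq : p = q
  · exact Or.inl (hB.ends h h' (Or.inl hpq))
  by_cases hq : q ∈ arc D p l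
  · exact Or.inr (Or.inl (aux h h' hq))
  by_cases hp : p ∈ arc D q m
  · exact Or.inr (Or.inr (Or.inl (aux h' h hp)))
  refine Or.inr (Or.inr (Or.inr ⟨?_, hpq, hp, hq⟩))
  rw [Finset.disjoint_left]
  intro x hx hx'
  obtain ⟨t, h1, h2, rfl⟩ := mem_arc.1 hx
  obtain ⟨u, h3, h4, h5⟩ := mem_arc.1 hx'
  rcases lt_trichotomy u t with hlt | rfl | hlt
  · refine hq (mem_arc.2 ⟨t - u, by omega, by omega, ?_⟩)
    rw [Nat.cast_sub hlt.le]
    linear_combination -h5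
  · exact hpq (add_right_cancel h5)
  · refine hp (mem_arc.2 ⟨u - t, by omega, by omega, ?_⟩)
    rw [Nat.cast_sub hlt.le]
    linear_combination h5

lemma prec_arc {s : ℕ} (hl : l ≤ D) (hs : 0 < s) (hm : s + m < l) :
    Prec D (arc D (p + s) m) (arc D p l) := by
  have hsub : arc D (p + s) m ⊆ arc D p l := by
    intro x hx
    obtain ⟨t, h1, h2, rfl⟩ := mem_arc.1 hx
    exact mem_arc.2 ⟨s + t, by omega, by omega, by push_cast; ring⟩
  have h1 : p + (s : ZMod (D + 1)) ∈ arc D p l := (add_mem_arc (by omega) hl).2 (by omega)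
  refine ⟨⟨hsub, fun h => self_notMem_arc (by omega) (h h1)⟩, arc D p s,
    arc D (p + (s + m : ℕ)) (l - (s + m)),
    isInterval_iff.2 ⟨_, _, hs, by omega, rfl⟩,
    isInterval_iff.2 ⟨_, _, by omega, by omega, rfl⟩, ?_, ?_⟩
  · rw [Finset.disjoint_left]
    intro x
    obtain ⟨u, hu, rfl⟩ := exists_eq_add_natCast p x
    rw [add_mem_arc hu (by omega), add_mem_arc_add hu (by omega)]
    omega
  · ext x
    obtain ⟨u, hu, rfl⟩ := exists_eq_add_natCast p x
    rw [Finset.mem_sdiff, Finset.mem_union, add_mem_arc hu (by omega),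
      add_mem_arc hu (by omega), add_mem_arc_add hu (by omega), add_mem_arc_add hu (by omega)]
    omega

lemma odd_of_uncovered (hB : IsMatching B) (h : HasArc B p l) {t : ℕ} (h0 : 0 < t) (htl : t ≤ l)
    (hun : ∀ s k : ℕ, HasArc B (p + s) k → 0 < s → s + k < l → s < t → s + k < t) : Odd t := by
  refine hB.odd_of_closed h0 (by have := h.2.1; omega) (p := p) fun u hu hut => ?_
  obtain ⟨s, k, hk, h1, h2, h3⟩ := hB.inner h u hu (by omega)
  exact ⟨s, k, hk, h1, hun s k hk h1 h2 (by omega), h3⟩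

lemma even_of_mem_evSet {t : ℕ} (hl : l ≤ D) (htD : t ≤ D)
    (h : p + (t : ZMod (D + 1)) ∈ evSet D (arc D p l)) : Even t := by
  obtain ⟨hmem, I', I'', ho', ho'', ⟨hdis, hnot⟩, hun⟩ :=
    (@Finset.mem_filter _ _ (Classical.decPred _) _ _).1 h
  rw [add_mem_arc htD hl] at hmem
  obtain ⟨q, k, hk, hkD, rfl⟩ := exists_arc_of_oddInterval ho'
  obtain ⟨q', k', hk', hkD', rfl⟩ := exists_arc_of_oddInterval ho''
  have hsub' := (Finset.subset_union_left.trans hun.symm.subset).trans (Finset.erase_subset _ _)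
  have hsub'' := (Finset.subset_union_right.trans hun.symm.subset).trans (Finset.erase_subset _ _)
  obtain ⟨s, rfl, hs⟩ := exists_of_arc_subset hk.pos hl hsub'
  obtain ⟨s', rfl, hs'⟩ := exists_of_arc_subset hk'.pos hl hsub''
  have hiff : ∀ u : ℕ, u ≤ D →
      ((u ≠ t ∧ 0 < u ∧ u ≤ l) ↔ (s < u ∧ u ≤ s + k) ∨ (s' < u ∧ u ≤ s' + k')) := by
    intro u hu
    have := Finset.ext_iff.1 hun (p + u)
    rw [Finset.mem_erase, Finset.mem_union, add_mem_arc hu hl, add_mem_arc_add hu (by omega),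
      add_mem_arc_add hu (by omega)] at this
    rw [← this]
    have : p + (u : ZMod (D + 1)) ≠ p + t ↔ u ≠ t :=
      ⟨fun h h' => h (by rw [h']), fun h h' => h (eq_of_add_natCast_eq (by omega) (by omega) h')⟩
    rw [this]
  have hdisj : ∀ u : ℕ, u ≤ D → ¬ ((s < u ∧ u ≤ s + k) ∧ (s' < u ∧ u ≤ s' + k')) := by
    intro u hu
    have := Finset.ext_iff.1 hdis (p + u)
    rw [Finset.mem_inter, add_mem_arc_add hu (by omega),
      add_mem_arc_add hu (by omega)] at this
    simpa using this
  have hk0 := hk.pos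
  have hk0' := hk'.pos
  have hne1 : s + k ≠ s' := by
    rintro rfl
    refine hnot (isInterval_iff.2 ⟨p + s, k + k', by omega, by omega, ?_⟩)
    rw [← arc_union_arc]
    push_cast
    rw [add_assoc]
  have hne2 : s' + k' ≠ s := by
    rintro rfl
    refine hnot (isInterval_iff.2 ⟨p + s', k' + k, by omega, by omega, ?_⟩)
    rw [← arc_union_arc, Finset.union_comm]
    push_cast
    rw [add_assoc]
  have e1 := hiff t htD
  have e2 := hiff 1 (by omega)
  rcases lt_or_ge s s' with hss | hss
  · have e5 := hdisj (s' + 1) (by omega)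
    have e3 := hiff (s + k + 1) (by omega)
    have hs0 : s = 0 ∨ t = 1 := by omega
    have ht : t = s + k + 1 := by omega
    rw [Nat.odd_iff] at hk
    rw [Nat.even_iff]
    omega
  · have e5 := hdisj (s + 1) (by omega)
    have e3 := hiff (s' + k' + 1) (by omega)
    have hs0 : s' = 0 ∨ t = 1 := by omega
    have ht : t = s' + k' + 1 := by omega
    rw [Nat.odd_iff] at hk'
    rw [Nat.even_iff]
    omega

theorem phi (hB : IsMatching B) : phi D B := by
  classical
  have harc : ∀ I ∈ B, ∃ p l, I = arc D p l ∧ HasArc B p l := by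
    intro I hI
    obtain ⟨p, l, h1, h2, rfl⟩ := exists_arc_of_oddInterval (hB.odd I hI)
    exact ⟨p, l, rfl, h1, h2, hI⟩
  refine ⟨hB.odd, ?_, ?_⟩
  · intro I hI I' hI'
    obtain ⟨p, l, rfl, h⟩ := harc I hI
    obtain ⟨q, m, rfl, h'⟩ := harc I' hI'
    rcases hB.laminar h h' with ⟨rfl, rfl⟩ | ⟨s, rfl, h1, h2⟩ | ⟨s, rfl, h1, h2⟩ |
      ⟨h1, h2, h3, h4⟩
    · exact Or.inl rfl
    · exact Or.inr (Or.inr (Or.inr (prec_arc h.2.1 h1 h2)))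
    · exact Or.inr (Or.inr (Or.inl (prec_arc h'.2.1 h1 h2)))
    · exact Or.inr (Or.inl ⟨Finset.disjoint_iff_inter_eq_empty.1 h1,
        not_isInterval_union h.1.pos h.2.1 h'.1.pos h'.2.1 h2 h3 h4⟩)
  · intro I hI
    obtain ⟨p, l, rfl, h⟩ := harc I hI
    have hlD := h.2.1
    let P : Finset (ZMod (D + 1)) → Prop := fun J => Prec D J (arc D p l)
    refine ⟨{J ∈ B | P J ∧ ∀ K ∈ B, P K → J ⊆ K → J = K}, Finset.filter_subset _ _, ?_, ?_, ?_⟩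
    · intro J hJ
      exact (Finset.mem_filter.1 hJ).2.1
    · intro J hJ J' hJ' hne
      obtain ⟨h1, h2, h3⟩ := Finset.mem_filter.1 hJ
      obtain ⟨h1', h2', h3'⟩ := Finset.mem_filter.1 hJ'
      obtain ⟨q, m, rfl, hq⟩ := harc J h1
      obtain ⟨q', m', rfl, hq'⟩ := harc J' h1'
      rcases hB.laminar hq hq' with ⟨rfl, rfl⟩ | ⟨s, rfl, h4, h5⟩ | ⟨s, rfl, h4, h5⟩ | ⟨h4, -⟩
      · exact absurd rfl hne
      · exact absurd (h3' _ h1 h2 (prec_arc hq.2.1 h4 h5).1.subset).symm hne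
      · exact absurd (h3 _ h1' h2' (prec_arc hq'.2.1 h4 h5).1.subset) hne
      · exact h4
    · intro x hx
      obtain ⟨t, h1, h2, rfl⟩ := mem_arc.1 ((@Finset.mem_filter _ _ (Classical.decPred _) _ _).1 hx).1
      have hev := even_of_mem_evSet hlD (by omega) hx
      have hcov : ∃ J ∈ B, P J ∧ p + (t : ZMod (D + 1)) ∈ J := by
        by_contra! hcon
        refine Nat.not_odd_iff_even.2 hev (hB.odd_of_uncovered h h1 h2 fun s k hk h3 h4 h5 => ?_)
        have := hcon _ hk.2.2 (prec_arc hlD h3 h4)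
        rw [add_mem_arc_add (by omega) (by omega)] at this
        omega
      obtain ⟨J, hJ, hmax⟩ := Finset.exists_max_image
        {J ∈ B | P J ∧ p + (t : ZMod (D + 1)) ∈ J} Finset.card (by
          obtain ⟨J, h3, h4⟩ := hcov
          exact ⟨J, Finset.mem_filter.2 ⟨h3, h4⟩⟩)
      obtain ⟨h3, h4, h5⟩ := Finset.mem_filter.1 hJ
      refine Finset.mem_biUnion.2 ⟨J, Finset.mem_filter.2 ⟨h3, h4, fun K hK hPK hJK => ?_⟩, h5⟩
      exact Finset.eq_of_subset_of_card_le hJK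
        (hmax K (Finset.mem_filter.2 ⟨hK, hPK, hJK h5⟩))

end IsMatching

section count

variable {B B' : Finset (Finset (ZMod (D + 1)))}

open scoped Classical in
/-- The starting points of the arcs in `B`. -/
noncomputable def starts (B : Finset (Finset (ZMod (D + 1)))) : Finset (ZMod (D + 1)) :=
  {p | ∃ l, HasArc B p l}

lemma mem_starts {p : ZMod (D + 1)} : p ∈ starts B ↔ ∃ l, HasArc B p l := by
  simp [starts]

lemma IsMatching.two_mul_card_starts_le (hB : IsMatching B) : 2 * (starts B).card ≤ D + 1 := by
  classical
  have hex : ∀ p, ∃ l, p ∈ starts B → HasArc B p l := by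
    intro p
    by_cases hp : p ∈ starts B
    · obtain ⟨l, hl⟩ := mem_starts.1 hp
      exact ⟨l, fun _ => hl⟩
    · exact ⟨0, fun h => absurd h hp⟩
  choose len hlen using hex
  have hcard : ((starts B).image fun p => p + (len p : ZMod (D + 1))).card = (starts B).card :=
    Finset.card_image_of_injOn fun p hp q hq h =>
      (hB.ends (hlen p hp) (hlen q hq) (Or.inr (Or.inr h))).1
  have hdisj : Disjoint (starts B)
      ((starts B).image fun p => p + (len p : ZMod (D + 1))) := by
    rw [Finset.disjoint_left]
    intro q hq hx
    obtain ⟨p, hp, h⟩ := Finset.mem_image.1 hx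
    have := (hB.ends (hlen q hq) (hlen p hp) (Or.inr (Or.inl h.symm))).1
    exact IsMatching.add_ne_self (hlen p hp) (h.trans this)
  have := Finset.card_le_univ
    (starts B ∪ (starts B).image fun p => p + (len p : ZMod (D + 1)))
  rw [Finset.card_union_of_disjoint hdisj, hcard, ZMod.card] at this
  omega

lemma IsMatching.not_lt_of_starts_eq (hB : IsMatching B) (hB' : IsMatching B')
    (h : starts B = starts B') {p : ZMod (D + 1)} {l l' : ℕ} (hl : HasArc B p l)
    (hl' : HasArc B' p l') : ¬ l < l' := by
  induction l using Nat.strong_induction_on generalizing p l' with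
  | _ l ih =>
    intro hlt
    obtain ⟨s, k', hk', h1, h2, h3⟩ := hB'.inner hl' l hl.1.pos hlt
    obtain ⟨k, hk⟩ := mem_starts.1 (h ▸ mem_starts.2 ⟨k', hk'⟩ : p + (s : ZMod (D + 1)) ∈ starts B)
    rcases h3 with rfl | rfl
    · have := (hB.ends hk hl (Or.inr (Or.inl rfl))).1
      exact add_ne_self hl this
    · have hk0 := hk'.1.pos
      obtain ⟨u, h4, h5, h6, h7⟩ := hB.inside hl h1 (by omega) hk (Or.inl rfl)
      have hl2 := hl.2.1
      have := eq_of_add_natCast_eq (by omega) (by omega) h4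
      exact ih k (by omega) hk hk' (by omega)

lemma IsMatching.subset_of_starts_eq (hB : IsMatching B) (hB' : IsMatching B')
    (h : starts B = starts B') : B ⊆ B' := by
  intro I hI
  obtain ⟨p, l, h1, h2, rfl⟩ := exists_arc_of_oddInterval (hB.odd I hI)
  have hl : HasArc B p l := ⟨h1, h2, hI⟩
  obtain ⟨l', hl'⟩ := mem_starts.1 (h ▸ mem_starts.2 ⟨l, hl⟩ : p ∈ starts B')
  have e1 := hB.not_lt_of_starts_eq hB' h hl hl'
  have e2 := hB'.not_lt_of_starts_eq hB h.symm hl' hl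
  obtain rfl : l = l' := by omega
  exact hl'.2.2

lemma IsMatching.eq_of_starts_eq (hB : IsMatching B) (hB' : IsMatching B')
    (h : starts B = starts B') : B = B' :=
  (hB.subset_of_starts_eq hB' h).antisymm (hB'.subset_of_starts_eq hB h.symm)

/-- The class of the indicator function of the set of starting points. -/
noncomputable def startClass (B : Finset (Finset (ZMod (D + 1)))) : Vsp D :=
  Submodule.Quotient.mk fun p => if p ∈ starts B then 1 else 0

lemma IsMatching.eq_of_startClass_eq (hD : Even D) (hB : IsMatching B) (hB' : IsMatching B')
    (h : startClass B = startClass B') : B = B' := by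
  apply hB.eq_of_starts_eq hB'
  rw [startClass, startClass, Submodule.Quotient.eq, Submodule.mem_span_singleton] at h
  obtain ⟨c, hc⟩ := h
  have hc' : ∀ p, c = (if p ∈ starts B then 1 else 0) - (if p ∈ starts B' then 1 else 0) := by
    intro p
    simpa [allOnes] using congrFun hc p
  by_cases h0 : c = 0
  · ext p
    have := hc' p
    rw [h0] at this
    by_cases h1 : p ∈ starts B <;> by_cases h2 : p ∈ starts B' <;> simp [h1, h2] at this ⊢
  · have hun : (Finset.univ : Finset (ZMod (D + 1))) ⊆ starts B ∪ starts B' := by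
      intro p _
      by_contra hp
      rw [Finset.mem_union, not_or] at hp
      have := hc' p
      simp [hp.1, hp.2] at this
      exact h0 this
    have h1 := (Finset.card_le_card hun).trans (Finset.card_union_le _ _)
    rw [Finset.card_univ, ZMod.card] at h1
    have h2 := hB.two_mul_card_starts_le
    have h3 := hB'.two_mul_card_starts_le
    grind

lemma card_phi_le (hD : Even D) : Nat.card {B // phi D B} ≤ Nat.card (Vsp D) :=
  Nat.card_le_card_of_injective (fun B : {B // phi D B} => startClass B.1) fun B B' h =>
    Subtype.ext (IsMatching.eq_of_startClass_eq hD (isMatching_of_phi hD B.2)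
      (isMatching_of_phi hD B'.2) h)

end count

section boundary

/-- The coordinates `x ↦ (x i + x (i + 1))_i` on `V_D`, in which the symplectic form becomes the
dot product. -/
noncomputable def bdry (D : ℕ) : Vsp D →ₗ[ZMod 2] Wsp D :=
  Submodule.liftQ _
    { toFun := fun x i => x i + x (i + 1)
      map_add' := fun x y => by ext i; simp only [Pi.add_apply]; ring
      map_smul' := fun c x => by ext i; simp [mul_add] } (by
    rw [Submodule.span_singleton_le_iff_mem, LinearMap.mem_ker]
    ext i
    exact CharTwo.add_self_eq_zero _)

lemma bdry_mk (x : Wsp D) (i : ZMod (D + 1)) :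
    bdry D (Submodule.Quotient.mk x) i = x i + x (i + 1) := rfl

lemma eq_zero_of_bdry_eq_zero {v : Vsp D} (h : bdry D v = 0) : v = 0 := by
  obtain ⟨x, rfl⟩ := Submodule.Quotient.mk_surjective _ v
  rw [Submodule.Quotient.mk_eq_zero, Submodule.mem_span_singleton]
  have hstep : ∀ i, x (i + 1) = x i := fun i => by
    have := congrFun h i
    rw [bdry_mk] at this
    exact (CharTwo.add_eq_zero.1 this).symm
  have hnat : ∀ n : ℕ, x (0 + n) = x 0 := by
    intro n
    induction n with
    | zero => simp
    | succ n ih => rw [← ih, ← hstep (0 + n)]; push_cast; rw [add_assoc]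
  refine ⟨x 0, ?_⟩
  ext i
  obtain ⟨u, -, rfl⟩ := exists_eq_add_natCast 0 i
  rw [hnat]
  simp [allOnes]

lemma sum_bdry (v : Vsp D) : ∑ i, bdry D v i = 0 := by
  obtain ⟨x, rfl⟩ := Submodule.Quotient.mk_surjective _ v
  have e : ∑ i, x (i + 1) = ∑ i, x i := Equiv.sum_comp (Equiv.addRight (1 : ZMod (D + 1))) x
  simp only [bdry_mk]
  rw [Finset.sum_add_distrib, e]
  exact CharTwo.add_self_eq_zero _

lemma formV_eq (x y : Vsp D) : formV D x y = ∑ i, bdry D x i * bdry D y i := by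
  have hx : bdry D x = fun i => Quotient.out x i + Quotient.out x (i + 1) := by
    conv_lhs => rw [← Quotient.out_eq x]
    rfl
  have hy : bdry D y = fun i => Quotient.out y i + Quotient.out y (i + 1) := by
    conv_lhs => rw [← Quotient.out_eq y]
    rfl
  rw [hx, hy, formV, formW]
  set a := Quotient.out x
  set b := Quotient.out y
  have h : ∑ i, (a i * b i + a (i + 1) * b (i + 1)) = 0 := by
    have e : ∑ i, a (i + 1) * b (i + 1) = ∑ i, a i * b i :=
      Equiv.sum_comp (Equiv.addRight (1 : ZMod (D + 1))) fun i => a i * b i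
    rw [Finset.sum_add_distrib, e]
    exact CharTwo.add_self_eq_zero _
  rw [← zero_add (∑ i, _), ← h, ← Finset.sum_add_distrib]
  refine Finset.sum_congr rfl fun i _ => ?_
  ring

lemma bdry_eV (j i : ZMod (D + 1)) :
    bdry D (eV D j) i = (if i = j then 1 else 0) + (if i + 1 = j then 1 else 0) := by
  rw [eV, bdry_mk, Pi.single_apply, Pi.single_apply]

lemma bdry_eSet_arc {p : ZMod (D + 1)} {l : ℕ} (hl : l ≤ D) (r : ZMod (D + 1)) :
    bdry D (eSet D (arc D p l)) r = (if r = p then 1 else 0) + (if r = p + l then 1 else 0) := by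
  induction l with
  | zero => simp [arc, eSet, CharTwo.add_self_eq_zero]
  | succ l ih =>
    have hins : arc D p (l + 1) = insert (p + 1 + (l : ZMod (D + 1))) (arc D p l) := by
      rw [arc, Finset.range_add_one, Finset.image_insert, arc]
    have hnot : p + 1 + (l : ZMod (D + 1)) ∉ arc D p l := by
      have : p + 1 + (l : ZMod (D + 1)) = p + ((l + 1 : ℕ) : ZMod (D + 1)) := by
        push_cast; ring
      rw [this, add_mem_arc hl (by omega)]
      omega
    have hadd : eSet D (arc D p (l + 1)) = eV D (p + 1 + l) + eSet D (arc D p l) := by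
      rw [hins, eSet, Finset.sum_insert hnot, eSet]
    rw [hadd, map_add, Pi.add_apply, ih (by omega), bdry_eV]
    have h1 : p + 1 + (l : ZMod (D + 1)) = p + ((l + 1 : ℕ) : ZMod (D + 1)) := by
      push_cast; ring
    have h2 : r + 1 = p + 1 + (l : ZMod (D + 1)) ↔ r = p + l :=
      ⟨fun h => by linear_combination h, fun h => by linear_combination h⟩
    simp only [h2]
    rw [h1]
    have := CharTwo.add_self_eq_zero (if r = p + (l : ZMod (D + 1)) then (1 : ZMod 2) else 0)
    linear_combination this

variable {B : Finset (Finset (ZMod (D + 1)))} {p q : ZMod (D + 1)} {l m : ℕ}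

/-- `x` is orthogonal to `⟨B⟩`. -/
def IsPerp (B : Finset (Finset (ZMod (D + 1)))) (x : Vsp D) : Prop :=
  ∀ q m, HasArc B q m → bdry D x q = bdry D x (q + m)

lemma IsPerp.add {x y : Vsp D} (hx : IsPerp B x) (hy : IsPerp B y) : IsPerp B (x + y) := by
  intro q m h
  rw [map_add, Pi.add_apply, Pi.add_apply, hx q m h, hy q m h]

lemma bdry_eSet_arc_of_notMatched (h : HasArc B p l) {r : ZMod (D + 1)} (hr : ¬ IsMatched B r) :
    bdry D (eSet D (arc D p l)) r = 0 := by
  rw [bdry_eSet_arc h.2.1, if_neg, if_neg, add_zero]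
  · exact fun hp => hr ⟨_, _, h, Or.inr hp⟩
  · exact fun hp => hr ⟨_, _, h, Or.inl hp⟩

lemma IsMatching.isPerp_eSet (hB : IsMatching B) (h : HasArc B p l) :
    IsPerp B (eSet D (arc D p l)) := by
  intro q m hq
  rw [bdry_eSet_arc h.2.1, bdry_eSet_arc h.2.1]
  by_cases hpq : q = p
  · obtain ⟨rfl, rfl⟩ := hB.ends hq h (Or.inl hpq)
    simp only [if_true, add_ne_self h, (add_ne_self h).symm, if_false]
    ring
  · have h1 : q ≠ p + l := fun h1 => hpq (hB.ends hq h (Or.inr (Or.inl h1))).1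
    have h2 : q + (m : ZMod (D + 1)) ≠ p := fun h1 =>
      hpq (hB.ends h hq (Or.inr (Or.inl h1.symm))).1.symm
    have h3 : q + (m : ZMod (D + 1)) ≠ p + l := fun h1 =>
      hpq (hB.ends hq h (Or.inr (Or.inr h1))).1
    simp [hpq, h1, h2, h3]

lemma eSet_mem_spanB (h : HasArc B p l) : eSet D (arc D p l) ∈ spanB D B :=
  Submodule.subset_span ⟨_, h.2.2, rfl⟩

lemma IsMatching.of_mem_spanB (hB : IsMatching B) {x : Vsp D} (hx : x ∈ spanB D B) :
    IsPerp B x ∧ ∀ r, ¬ IsMatched B r → bdry D x r = 0 := by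
  induction hx using Submodule.span_induction with
  | mem x hx =>
    obtain ⟨I, hI, rfl⟩ := hx
    obtain ⟨p, l, h1, h2, rfl⟩ := exists_arc_of_oddInterval (hB.odd I hI)
    have h : HasArc B p l := ⟨h1, h2, hI⟩
    exact ⟨hB.isPerp_eSet h, fun r hr => bdry_eSet_arc_of_notMatched h hr⟩
  | zero => exact ⟨fun q m _ => by simp, fun r _ => by simp⟩
  | add x y _ _ hx hy =>
    exact ⟨hx.1.add hy.1, fun r hr => by rw [map_add, Pi.add_apply, hx.2 r hr, hy.2 r hr, add_zero]⟩
  | smul c x _ hx =>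
    refine ⟨fun q m h => ?_, fun r hr => ?_⟩
    · rw [map_smul, Pi.smul_apply, Pi.smul_apply, hx.1 q m h]
    · rw [map_smul, Pi.smul_apply, hx.2 r hr, smul_zero]

lemma eq_one_of_ne_zero {c : ZMod 2} (h : c ≠ 0) : c = 1 := by
  revert c; decide

lemma IsMatching.mem_spanB (hB : IsMatching B) {x : Vsp D} (hx : IsPerp B x)
    (h0 : ∀ r, ¬ IsMatched B r → bdry D x r = 0) : x ∈ spanB D B := by
  classical
  induction hn : (Finset.univ.filter fun r => bdry D x r ≠ 0).card using
    Nat.strong_induction_on generalizing x with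
  | _ n ih =>
    by_cases hz : ∃ r, bdry D x r ≠ 0
    · obtain ⟨r, hr⟩ := hz
      have hmr : IsMatched B r := by
        by_contra hcon
        exact hr (h0 r hcon)
      obtain ⟨q, m, h, hrq⟩ := hmr
      have hq : bdry D x q = 1 := by
        apply eq_one_of_ne_zero
        rcases hrq with rfl | rfl
        · exact hr
        · rwa [hx q m h]
      have hqm : bdry D x (q + m) = 1 := by rw [← hx q m h, hq]
      have hxe : x + eSet D (arc D q m) ∈ spanB D B := by
        refine ih _ ?_ (hx.add (hB.isPerp_eSet h)) (fun r hr => ?_) rfl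
        · rw [← hn]
          apply Finset.card_lt_card
          rw [Finset.ssubset_iff_of_subset]
          · refine ⟨q, by simp [hq], ?_⟩
            simp [bdry_eSet_arc h.2.1, hq, (add_ne_self h).symm, CharTwo.add_self_eq_zero]
          · intro r hr
            simp only [Finset.mem_filter, Finset.mem_univ, true_and, map_add, Pi.add_apply,
              bdry_eSet_arc h.2.1] at hr ⊢
            intro hr0
            apply hr
            have h1 : r ≠ q := fun h1 => by rw [h1, hq] at hr0; exact one_ne_zero hr0
            have h2 : r ≠ q + m := fun h1 => by rw [h1, hqm] at hr0; exact one_ne_zero hr0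
            simp [h1, h2, hr0]
        · rw [map_add, Pi.add_apply, h0 r hr, bdry_eSet_arc_of_notMatched h hr, add_zero]
      exact (Submodule.add_mem_iff_left _ (eSet_mem_spanB h)).1 hxe
    · push Not at hz
      rw [eq_zero_of_bdry_eq_zero (funext hz)]
      exact zero_mem _

lemma IsMatching.formV_eq_zero (hB : IsMatching B) {x y : Vsp D} (hx : x ∈ spanB D B)
    (hy : IsPerp B y) : formV D x y = 0 := by
  obtain ⟨h1, h2⟩ := hB.of_mem_spanB hx
  rw [formV_eq]
  refine hB.sum_eq_zero _ (fun q m h => ?_) fun r hr => ?_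
  · rw [h1 q m h, hy q m h]
  · rw [h2 r hr, zero_mul]

lemma formV_eSet_arc {y : Vsp D} (hl : l ≤ D) :
    formV D (eSet D (arc D p l)) y = bdry D y p + bdry D y (p + l) := by
  rw [formV_eq]
  simp [bdry_eSet_arc hl, add_mul, Finset.sum_add_distrib]

end boundary

section cosets

variable {B : Finset (Finset (ZMod (D + 1)))}

lemma add_natCast_ne_self (a : ZMod (D + 1)) {s : ℕ} (h1 : 1 ≤ s) (h2 : s ≤ D) :
    a + (s : ZMod (D + 1)) ≠ a := by
  intro h
  have : s = 0 := eq_of_add_natCast_eq (D := D) (p := a) (by omega) (by omega) (by simpa using h)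
  omega

lemma isPerp_eSet_of_notMatched {a : ZMod (D + 1)} {s : ℕ} (hs : s ≤ D) (ha : ¬ IsMatched B a)
    (hb : ¬ IsMatched B (a + s)) : IsPerp B (eSet D (arc D a s)) := by
  intro q m h
  have h1 : ∀ r, IsMatched B r → bdry D (eSet D (arc D a s)) r = 0 := by
    intro r hr
    rw [bdry_eSet_arc hs, if_neg, if_neg, add_zero]
    · rintro rfl
      exact hb hr
    · rintro rfl
      exact ha hr
  rw [h1 q ⟨_, _, h, Or.inl rfl⟩, h1 _ ⟨_, _, h, Or.inr rfl⟩]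

open scoped Classical in
/-- The unmatched coordinates at which `bdry D x` is `1`. -/
noncomputable def onesOf (B : Finset (Finset (ZMod (D + 1)))) (x : Vsp D) :
    Finset (ZMod (D + 1)) :=
  {r | ¬ IsMatched B r ∧ bdry D x r = 1}

lemma mem_onesOf {x : Vsp D} {r : ZMod (D + 1)} :
    r ∈ onesOf B x ↔ ¬ IsMatched B r ∧ bdry D x r = 1 := by
  simp [onesOf]

lemma IsMatching.exists_odd_gap (hD : Even D) (hB : IsMatching B) {x : Vsp D} (hx : IsPerp B x)
    (hne : (onesOf B x).Nonempty) :
    ∃ a g, Odd g ∧ g ≤ D ∧ a ∈ onesOf B x ∧ a + (g : ZMod (D + 1)) ∈ onesOf B x := by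
  obtain ⟨a, ha⟩ := hne
  have hb : ∃ b ∈ onesOf B x, b ≠ a := by
    by_contra! hcon
    have h := hB.sum_eq_zero (fun r => bdry D x r - (Pi.single a 1 : Wsp D) r)
      (fun q m h => ?_) fun r hr => ?_
    · rw [Finset.sum_sub_distrib, sum_bdry, Finset.sum_pi_single'] at h
      simp at h
    · have h1 : ∀ r, IsMatched B r → (Pi.single a 1 : Wsp D) r = 0 := fun r hr => by
        rw [Pi.single_apply, if_neg]
        rintro rfl
        exact (mem_onesOf.1 ha).1 hr
      simp only [h1 q ⟨_, _, h, Or.inl rfl⟩, h1 _ ⟨_, _, h, Or.inr rfl⟩, hx q m h]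
    · by_cases hra : r = a
      · subst hra
        simp [(mem_onesOf.1 ha).2]
      · simp only [Pi.single_apply, hra, if_false, sub_zero]
        by_contra h0
        exact hra (hcon r (mem_onesOf.2 ⟨hr, eq_one_of_ne_zero h0⟩))
  obtain ⟨b, hb, hba⟩ := hb
  obtain ⟨u, hu, rfl⟩ := exists_eq_add_natCast a b
  rcases Nat.even_or_odd u with he | ho
  · have hu0 : u ≠ 0 := by
      rintro rfl
      simp at hba
    refine ⟨a + u, D + 1 - u, ?_, by omega, hb, ?_⟩
    · grind
    · rw [add_assoc, ← Nat.cast_add, show u + (D + 1 - u) = D + 1 by omega, ZMod.natCast_self,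
        add_zero]
      exact ha
  · exact ⟨a, u, ho, hu, ha, hb⟩

/-- An induction principle for the vectors orthogonal to `⟨B⟩`. -/
theorem IsMatching.perp_induction (hD : Even D) (hB : IsMatching B) {P : Vsp D → Prop}
    (hspan : ∀ x ∈ spanB D B, P x)
    (hflip : ∀ (x : Vsp D) (a : ZMod (D + 1)) (s : ℕ), Odd s → s ≤ D → ¬ IsMatched B a →
      ¬ IsMatched B (a + s) → IsMatching (insert (arc D a s) B) → IsPerp B x →
      bdry D x a = bdry D x (a + s) → P (x + eSet D (arc D a s)) → P x)
    {x : Vsp D} (hx : IsPerp B x) : P x := by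
  classical
  induction hw : (onesOf B x).card using Nat.strong_induction_on generalizing x with
  | _ w ihw =>
  have key : ∀ g : ℕ, Odd g → g ≤ D → ∀ (y : Vsp D) (a : ZMod (D + 1)), IsPerp B y →
      (onesOf B y).card = w → a ∈ onesOf B y → a + (g : ZMod (D + 1)) ∈ onesOf B y → P y := by
    intro g
    induction g using Nat.strong_induction_on with
    | _ g ihg =>
    intro hgo hgD y a hy hyw ha hag
    obtain ⟨ha1, ha2⟩ := mem_onesOf.1 ha
    obtain ⟨hg1, hg2⟩ := mem_onesOf.1 hag
    -- two ones joined by an insertable arc can be removed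
    have hremove : ∀ (z : Vsp D) (s : ℕ), IsPerp B z → bdry D z a = 1 → bdry D z (a + s) = 1 →
        Odd s → s ≤ D → ¬ IsMatched B (a + s) → IsMatching (insert (arc D a s) B) →
        P (z + eSet D (arc D a s)) → P z := fun z s hz h1 h2 hso hsD hs hins hP =>
      hflip z a s hso hsD ha1 hs hins hz (by rw [h1, h2]) hP
    obtain ⟨s, hs1, hsg, hs, hso, hins⟩ := hB.exists_insert ha1 hg1 hgo.pos hgD
    by_cases hb : bdry D y (a + s) = 1
    · refine hremove y s hy ha2 hb hso (by omega) hs hins ?_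
      refine ihw _ ?_ (hy.add (isPerp_eSet_of_notMatched (by omega) ha1 hs)) rfl
      rw [← hyw]
      apply Finset.card_lt_card
      rw [Finset.ssubset_iff_of_subset]
      · refine ⟨a, ha, ?_⟩
        have := (add_natCast_ne_self a hs1 (by omega)).symm
        simp [mem_onesOf, bdry_eSet_arc (show s ≤ D by omega), ha2, this,
          CharTwo.add_self_eq_zero]
      · intro r hr
        rw [mem_onesOf, map_add, Pi.add_apply, bdry_eSet_arc (by omega)] at hr
        rw [mem_onesOf]
        refine ⟨hr.1, ?_⟩
        by_cases h1 : r = a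
        · rw [h1, ha2]
        · by_cases h2 : r = a + s
          · rw [h2, hb]
          · simpa [h1, h2] using hr.2
    · have hsg' : s < g := lt_of_le_of_ne hsg fun h => hb (h ▸ hg2)
      have hb0 : bdry D y (a + s) = 0 := by
        by_contra h0
        exact hb (eq_one_of_ne_zero h0)
      have hgs : a + (s : ZMod (D + 1)) + ((g - s : ℕ) : ZMod (D + 1)) = a + g := by
        rw [add_assoc, ← Nat.cast_add, show s + (g - s) = g by omega]
      obtain ⟨t, ht1, htg, ht, hto, hins'⟩ := hB.exists_insert (g := g - s) hs
        (by rwa [hgs]) (by omega) (by omega)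
      have hst : a + (s : ZMod (D + 1)) + (t : ZMod (D + 1)) = a + ((s + t : ℕ) : ZMod (D + 1)) := by
        push_cast; ring
      have hstg : s + t < g := by
        have : s + t ≠ g := by
          rintro rfl
          exact Nat.not_even_iff_odd.2 hgo (hso.add_odd hto)
        omega
      have hgo' : Odd (g - (s + t)) := by grind
      have hgst : a + (s : ZMod (D + 1)) + (t : ZMod (D + 1)) + ((g - (s + t) : ℕ) : ZMod (D + 1))
          = a + g := by
        rw [hst, add_assoc, ← Nat.cast_add, show s + t + (g - (s + t)) = g by omega]
      by_cases hc : bdry D y (a + s + t) = 1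
      · exact ihg _ (by omega) hgo' (by omega) y _ hy hyw (mem_onesOf.2 ⟨ht, hc⟩)
          (by rwa [hgst])
      · have hc0 : bdry D y (a + s + t) = 0 := by
          by_contra h0
          exact hc (eq_one_of_ne_zero h0)
        have hab := add_natCast_ne_self a hs1 (by omega)
        have hbc := add_natCast_ne_self (a + (s : ZMod (D + 1))) ht1 (by omega)
        have hac : a + (s : ZMod (D + 1)) + (t : ZMod (D + 1)) ≠ a := by
          rw [hst]
          exact add_natCast_ne_self a (by omega) (by omega)
        have htD : t ≤ D := by omega
        have hsD : s ≤ D := by omega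
        refine hflip y (a + s) t hto htD hs ht hins' hy (by rw [hb0, hc0]) ?_
        have hy1 := hy.add (isPerp_eSet_of_notMatched htD hs ht)
        have hy2 := hy1.add (isPerp_eSet_of_notMatched hsD ha1 hs)
        refine hremove _ s hy1 ?_ ?_ hso hsD hs hins ?_
        · simp [bdry_eSet_arc htD, ha2, hab.symm, hac.symm]
        · simp [bdry_eSet_arc htD, hb0, hbc.symm]
        · have hones : onesOf B (y + eSet D (arc D (a + s) t) + eSet D (arc D a s)) =
              insert (a + (s : ZMod (D + 1)) + (t : ZMod (D + 1))) ((onesOf B y).erase a) := by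
            ext r
            rw [Finset.mem_insert, Finset.mem_erase, mem_onesOf, mem_onesOf, map_add, map_add,
              Pi.add_apply, Pi.add_apply, bdry_eSet_arc htD, bdry_eSet_arc hsD]
            by_cases h1 : r = a
            · subst h1
              simp [ha2, hab.symm, hac.symm, CharTwo.add_self_eq_zero]
            · by_cases h2 : r = a + s
              · rw [h2]
                simp [hb0, hab, hbc.symm, CharTwo.add_self_eq_zero]
              · by_cases h3 : r = a + s + t
                · rw [h3]
                  simp [hc0, hac, hbc, ht]
                · simp [h1, h2, h3]
          have hgc : a + (g : ZMod (D + 1)) ≠ a := add_natCast_ne_self a hgo.pos hgD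
          refine ihg _ (by omega) hgo' (by omega) _ (a + s + t) hy2 ?_ ?_ ?_
          · rw [hones, Finset.card_insert_of_notMem, Finset.card_erase_add_one ha, hyw]
            simp [mem_onesOf, hc0]
          · rw [hones]
            exact Finset.mem_insert_self _ _
          · rw [hgst, hones]
            exact Finset.mem_insert_of_mem (Finset.mem_erase.2 ⟨hgc, hag⟩)
  rcases (onesOf B x).eq_empty_or_nonempty with h | h
  · refine hspan x (hB.mem_spanB hx fun r hr => ?_)
    by_contra h0
    have : r ∈ onesOf B x := mem_onesOf.2 ⟨hr, eq_one_of_ne_zero h0⟩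
    rw [h] at this
    exact Finset.notMem_empty _ this
  · obtain ⟨a, g, h1, h2, h3, h4⟩ := hB.exists_odd_gap hD hx h
    exact key g h1 h2 x a hx hw h3 h4

/-- The span of the indicator functions of the `⟨B'⟩` with `B'` containing `B`. -/
noncomputable def upperSpan (B : Finset (Finset (ZMod (D + 1)))) :
    Submodule ℂ (Vsp D → ℂ) :=
  Submodule.span ℂ ((fun B' => ind D ↑(spanB D B')) '' {B' | phi D B' ∧ B ⊆ B'})

lemma upperSpan_anti {B B' : Finset (Finset (ZMod (D + 1)))} (h : B ⊆ B') :
    upperSpan B' ≤ upperSpan B :=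
  Submodule.span_mono (Set.image_mono fun _ hC => ⟨hC.1, h.trans hC.2⟩)

theorem IsMatching.ind_coset_mem (hD : Even D) (hB : IsMatching B) {x : Vsp D}
    (hx : IsPerp B x) : ind D {y | y - x ∈ spanB D B} ∈ upperSpan B := by
  induction B using WellFoundedGT.induction generalizing x with
  | _ B ih =>
  refine hB.perp_induction hD (P := fun x => ind D {y | y - x ∈ spanB D B} ∈ upperSpan B)
    (fun x hx => ?_) (fun x a s hso hsD ha hb hins hx hab hP => ?_) hx
  · have : {y | y - x ∈ spanB D B} = ↑(spanB D B) := by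
      ext y
      exact Submodule.sub_mem_iff_left _ hx
    rw [this]
    exact Submodule.subset_span ⟨B, ⟨hB.phi, Finset.Subset.refl B⟩, rfl⟩
  · set e := eSet D (arc D a s) with he
    have hea : bdry D e a = 1 := by
      rw [he, bdry_eSet_arc hsD, if_pos rfl, if_neg (add_natCast_ne_self a hso.pos hsD).symm,
        add_zero]
    have heB : e ∉ spanB D B := fun h => by
      have := (hB.of_mem_spanB h).2 a ha
      rw [hea] at this
      exact one_ne_zero this
    have hnot : arc D a s ∉ B := fun h => ha ⟨a, s, ⟨hso, hsD, h⟩, Or.inl rfl⟩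
    have hx' : IsPerp (insert (arc D a s) B) x := by
      intro q m h
      rcases (hasArc_insert hso hsD).1 h with h | ⟨rfl, rfl⟩
      · exact hx q m h
      · exact hab
    have h1 := upperSpan_anti (Finset.subset_insert _ _)
      (ih _ (Finset.ssubset_insert hnot) hins hx')
    have hspan : ∀ v, v ∈ spanB D (insert (arc D a s) B) ↔ v ∈ spanB D B ∨ v - e ∈ spanB D B := by
      intro v
      rw [spanB, Finset.coe_insert, Set.image_insert_eq, Submodule.mem_span_insert, ← he]
      constructor
      · rintro ⟨c, z, hz, rfl⟩
        change z ∈ spanB D B at hz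
        by_cases hc : c = 0
        · left
          simpa [hc] using hz
        · right
          simpa [eq_one_of_ne_zero hc] using hz
      · rintro (h | h)
        · exact ⟨0, v, h, by simp⟩
        · exact ⟨1, _, h, by simp⟩
    have hsum : ind D {y | y - x ∈ spanB D (insert (arc D a s) B)} =
        ind D {y | y - x ∈ spanB D B} + ind D {y | y - (x + e) ∈ spanB D B} := by
      classical
      ext y
      have h2 : y - (x + e) = y - x - e := by abel
      simp only [ind, Pi.add_apply, Set.indicator_apply, Set.mem_ofPred_eq, hspan, h2, Pi.one_apply]
      by_cases h3 : y - x ∈ spanB D B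
      · have : y - x - e ∉ spanB D B := fun h4 => heB (by
          have := (spanB D B).sub_mem h3 h4
          rwa [sub_sub_cancel] at this)
        simp [h3, this]
      · simp [h3]
    rw [hsum] at h1
    exact (Submodule.add_mem_iff_left _ hP).1 h1

end cosets

section fourier

variable {B : Finset (Finset (ZMod (D + 1)))}

open scoped Classical in
theorem IsMatching.mem_upperSpan (hD : Even D) (hB : IsMatching B) {f : Vsp D → ℂ}
    (hf : ∀ y, f y ≠ 0 → IsPerp B y) (hinv : ∀ x ∈ spanB D B, ∀ y, f (x + y) = f y) :
    f ∈ upperSpan B := by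
  let _ : Fintype (Vsp D) := Fintype.ofFinite _
  have h : ((Finset.univ.filter fun v => v ∈ spanB D B).card : ℂ) • f =
      ∑ x, f x • ind D {y | y - x ∈ spanB D B} := by
    ext y
    have h1 : ∀ x, f x * (if y - x ∈ spanB D B then (1 : ℂ) else 0) =
        if y - x ∈ spanB D B then f y else 0 := by
      intro x
      split_ifs with hx
      · rw [mul_one, ← hinv _ hx x, sub_add_cancel]
      · rw [mul_zero]
    simp only [Finset.sum_apply, Pi.smul_apply, ind, Set.indicator_apply, Set.mem_ofPred_eq,
      Pi.one_apply, smul_eq_mul, h1]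
    have e : ∑ x, (if y - x ∈ spanB D B then f y else 0) =
        ∑ v, if v ∈ spanB D B then f y else 0 :=
      Equiv.sum_comp (Equiv.subLeft y) fun v => if v ∈ spanB D B then f y else 0
    rw [e, ← Finset.sum_filter, Finset.sum_const, nsmul_eq_mul]
  have hc : ((Finset.univ.filter fun v => v ∈ spanB D B).card : ℂ) ≠ 0 := by
    rw [Nat.cast_ne_zero, Finset.card_ne_zero]
    exact ⟨0, by simp⟩
  rw [← Submodule.smul_mem_iff _ hc, h]
  refine Submodule.sum_mem _ fun x _ => ?_
  by_cases hx : f x = 0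
  · rw [hx, zero_smul]
    exact zero_mem _
  · exact Submodule.smul_mem _ _ (hB.ind_coset_mem hD (hf x hx))

lemma isMatching_empty : IsMatching (∅ : Finset (Finset (ZMod (D + 1)))) where
  odd := by simp
  ends := fun h => absurd h.2.2 (Finset.notMem_empty _)
  inner := fun h => absurd h.2.2 (Finset.notMem_empty _)

lemma upperSpan_empty (hD : Even D) : upperSpan (∅ : Finset (Finset (ZMod (D + 1)))) = ⊤ := by
  rw [eq_top_iff]
  intro f _
  refine isMatching_empty.mem_upperSpan hD (fun y _ q m h => absurd h.2.2 (Finset.notMem_empty _))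
    fun x hx y => ?_
  have : x = 0 := by simpa [spanB] using hx
  rw [this, zero_add]

theorem linearIndependent_ind_spanB (hD : Even D) :
    LinearIndependent ℂ fun B : {B // phi D B} => ind D ↑(spanB D B.1) := by
  classical
  let _ : Fintype (Vsp D) := Fintype.ofFinite _
  have hspan : ⊤ ≤ Submodule.span ℂ
      (Set.range fun B : {B // phi D B} => ind D ↑(spanB D B.1)) := by
    rw [← upperSpan_empty hD]
    refine Submodule.span_mono ?_
    rintro _ ⟨B, hB, rfl⟩
    exact ⟨⟨B, hB.1⟩, rfl⟩
  apply linearIndependent_of_top_le_span_of_card_eq_finrank hspan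
  have h1 := card_phi_le hD
  rw [Nat.card_eq_fintype_card, Nat.card_eq_fintype_card] at h1
  have h2 := finrank_range_le_card (R := ℂ) fun B : {B // phi D B} => ind D ↑(spanB D B.1)
  rw [Set.finrank, top_le_iff.1 hspan, finrank_top, Module.finrank_fintype_fun_eq_card] at h2
  rw [Module.finrank_fintype_fun_eq_card]
  omega

lemma fourierV_apply [Fintype (Vsp D)] (f : Vsp D → ℂ) (y : Vsp D) :
    fourierV D f y = (2 : ℂ) ^ (-((D / 2 : ℕ) : ℤ)) *
      ∑ x : Vsp D, (if formV D x y = 0 then (1 : ℂ) else -1) * f x := by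
  rw [fourierV, finsum_eq_sum_of_fintype]

lemma formV_add_left (x x' y : Vsp D) : formV D (x + x') y = formV D x y + formV D x' y := by
  simp [formV_eq, add_mul, Finset.sum_add_distrib]

lemma formV_comm (x y : Vsp D) : formV D x y = formV D y x := by
  simp [formV_eq, mul_comm]

lemma formV_add_right (x y y' : Vsp D) : formV D x (y + y') = formV D x y + formV D x y' := by
  rw [formV_comm, formV_add_left, formV_comm y, formV_comm y']

lemma sign_add (a b : ZMod 2) : (if a + b = 0 then (1 : ℂ) else -1) =
    (if a = 0 then 1 else -1) * (if b = 0 then 1 else -1) := by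
  have h : ∀ c : ZMod 2, c = 0 ∨ c = 1 := by decide
  rcases h a with rfl | rfl <;> rcases h b with rfl | rfl <;> simp [CharTwo.add_self_eq_zero]

lemma sum_sign_eq_zero [Fintype (Vsp D)] {v e : Vsp D} (h : formV D v e = 1) (s : Vsp D → ℂ)
    (hs : ∀ x, s (v + x) = s x) :
    ∑ x : Vsp D, (if formV D x e = 0 then (1 : ℂ) else -1) * s x = 0 := by
  have h1 : ∑ x : Vsp D, (if formV D (v + x) e = 0 then (1 : ℂ) else -1) * s (v + x) =
      ∑ x : Vsp D, (if formV D x e = 0 then (1 : ℂ) else -1) * s x :=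
    Equiv.sum_comp (Equiv.addLeft v) fun x => (if formV D x e = 0 then (1 : ℂ) else -1) * s x
  simp only [formV_add_left, sign_add, hs, h, one_ne_zero, if_false, neg_mul, one_mul,
    Finset.sum_neg_distrib] at h1
  linear_combination -(1 / 2 : ℂ) * h1

theorem IsMatching.fourierV_mem_upperSpan (hD : Even D) (hB : IsMatching B) :
    fourierV D (ind D ↑(spanB D B)) ∈ upperSpan B := by
  classical
  let _ : Fintype (Vsp D) := Fintype.ofFinite _
  refine hB.mem_upperSpan hD (fun y hy => ?_) fun v hv y => ?_
  · intro q m h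
    by_contra hne
    apply hy
    have h1 : formV D (eSet D (arc D q m)) y = 1 := by
      apply eq_one_of_ne_zero
      rw [formV_eSet_arc h.2.1]
      exact fun h0 => hne (CharTwo.add_eq_zero.1 h0)
    rw [fourierV_apply, sum_sign_eq_zero h1, mul_zero]
    intro x
    simp only [ind, Set.indicator_apply, SetLike.mem_coe,
      Submodule.add_mem_iff_right _ (eSet_mem_spanB h), Pi.one_apply]
  · rw [fourierV_apply, fourierV_apply]
    congr 1
    refine Finset.sum_congr rfl fun x _ => ?_
    by_cases hx : x ∈ spanB D B
    · rw [formV_add_right, hB.formV_eq_zero hx (hB.of_mem_spanB hv).1, zero_add]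
    · simp [ind, hx]

lemma card_Vsp : Nat.card (Vsp D) = 2 ^ D := by
  have h := Submodule.card_eq_card_quotient_mul_card
    (Submodule.span (ZMod 2) {allOnes D})
  have h1 : Nat.card (Submodule.span (ZMod 2) {allOnes D}) = 2 := by
    have : allOnes D ≠ 0 := fun h => one_ne_zero (congrFun h 0)
    rw [← Nat.card_congr (LinearEquiv.toSpanNonzeroSingleton (ZMod 2) _ (allOnes D) this).toEquiv]
    simp
  have h2 : Nat.card (Wsp D) = 2 ^ (D + 1) := by
    rw [Nat.card_fun]
    simp
  rw [h1, h2, pow_succ] at h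
  change 2 ^ D * 2 = 2 * Nat.card (Vsp D) at h
  omega

lemma exists_formV_eq_one (hD : Even D) {y : Vsp D} (hy : y ≠ 0) : ∃ v, formV D v y = 1 := by
  by_contra! hcon
  apply hy
  apply eq_zero_of_bdry_eq_zero
  have h0 : ∀ v, formV D v y = 0 := fun v => by
    by_contra h
    exact hcon v (eq_one_of_ne_zero h)
  have hstep : ∀ (i : ZMod (D + 1)) (n : ℕ), n ≤ D → bdry D y i = bdry D y (i + n) := by
    intro i n hn
    have := h0 (eSet D (arc D i n))
    rw [formV_eSet_arc hn] at this
    exact CharTwo.add_eq_zero.1 this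
  have hconst : ∀ i, bdry D y i = bdry D y 0 := by
    intro i
    obtain ⟨u, hu, rfl⟩ := exists_eq_add_natCast 0 i
    exact (hstep 0 u hu).symm
  have hsum := sum_bdry y
  simp only [hconst] at hsum
  rw [Finset.sum_const, Finset.card_univ, ZMod.card, nsmul_eq_mul, Nat.cast_add,
    (ZMod.natCast_eq_zero_iff_even).2 hD] at hsum
  ext i
  rw [hconst]
  simpa using hsum

theorem fourierV_fourierV (hD : Even D) (f : Vsp D → ℂ) : fourierV D (fourierV D f) = f := by
  classical
  let _ : Fintype (Vsp D) := Fintype.ofFinite _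
  ext z
  have hz : ∀ x : Vsp D, ∑ y : Vsp D, (if formV D y z = 0 then (1 : ℂ) else -1) *
      (if formV D x y = 0 then (1 : ℂ) else -1) = if x = z then (2 : ℂ) ^ D else 0 := by
    intro x
    have h1 : ∀ y : Vsp D, (if formV D y z = 0 then (1 : ℂ) else -1) *
        (if formV D x y = 0 then (1 : ℂ) else -1) =
        (if formV D y (z + x) = 0 then (1 : ℂ) else -1) * 1 := by
      intro y
      rw [formV_add_right, sign_add, formV_comm x y, mul_one]
    rw [Finset.sum_congr rfl fun y _ => h1 y]
    split_ifs with hxz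
    · subst hxz
      have : ∀ y : Vsp D, formV D y (x + x) = 0 := fun y => by
        rw [formV_add_right, CharTwo.add_self_eq_zero]
      simp only [this, if_true, mul_one, Finset.sum_const, Finset.card_univ, nsmul_eq_mul]
      rw [← Nat.card_eq_fintype_card, card_Vsp]
      push_cast
      rfl
    · have hne : z + x ≠ 0 := fun h => hxz (by
        rw [← ZModModule.sub_eq_add, sub_eq_zero] at h
        exact h.symm)
      obtain ⟨v, hv⟩ := exists_formV_eq_one hD hne
      exact sum_sign_eq_zero hv (fun _ => 1) fun _ => rfl
  have hswap : ∑ y : Vsp D, (if formV D y z = 0 then (1 : ℂ) else -1) *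
      ∑ x : Vsp D, (if formV D x y = 0 then (1 : ℂ) else -1) * f x = 2 ^ D * f z := by
    simp only [Finset.mul_sum]
    rw [Finset.sum_comm]
    simp only [← mul_assoc, ← Finset.sum_mul, hz]
    simp
  rw [fourierV_apply]
  simp only [fourierV_apply]
  simp only [mul_left_comm _ ((2 : ℂ) ^ (-((D / 2 : ℕ) : ℤ)))]
  rw [← Finset.mul_sum, hswap, ← mul_assoc, ← mul_assoc, ← zpow_natCast, ← zpow_add₀ two_ne_zero,
    ← zpow_add₀ two_ne_zero]
  obtain ⟨k, hk⟩ := hD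
  rw [show -((D / 2 : ℕ) : ℤ) + -((D / 2 : ℕ) : ℤ) + (D : ℤ) = 0 by omega, zpow_zero, one_mul]

end fourier

section order

variable {B : Finset (Finset (ZMod (D + 1)))}

lemma two_mul_sum_card_filter_subset {α : Type*} [DecidableEq α] {S : Finset (Finset α)}
    (hS : ∀ I ∈ S, ∀ J ∈ S, I ⊆ J ∨ J ⊆ I) :
    2 * ∑ I ∈ S, (S.filter fun J => I ⊆ J).card = S.card * (S.card + 1) := by
  have h : ∀ I ∈ S, ∀ J ∈ S, (if I ⊆ J then 1 else 0) + (if J ⊆ I then 1 else 0) =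
      1 + if I = J then 1 else 0 := by
    intro I hI J hJ
    by_cases h1 : I ⊆ J
    · by_cases h2 : J ⊆ I
      · simp [h1.antisymm h2]
      · simp [h1, h2, show I ≠ J from fun h => h2 h.ge]
    · simp [h1, (hS I hI J hJ).resolve_left h1, show I ≠ J from fun h => h1 h.le]
  have h2 := Finset.sum_congr rfl fun I hI => Finset.sum_congr (rfl : S = S) (h I hI)
  simp only [Finset.sum_add_distrib] at h2
  have hcomm : ∑ I ∈ S, ∑ J ∈ S, (if J ⊆ I then 1 else 0) =
      ∑ I ∈ S, ∑ J ∈ S, if I ⊆ J then 1 else 0 := Finset.sum_comm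
  rw [hcomm] at h2
  simp only [Finset.card_filter]
  rw [two_mul, h2]
  simp [mul_add]

theorem epsB_mem_spanB (hB : phi D B) : epsB D B ∈ spanB D B := by
  classical
  have hg : ∀ i, ∑ I ∈ B with i ∈ I, (B.filter fun J => I ⊆ J).card =
      gB D B i * (gB D B i + 1) / 2 := by
    intro i
    rw [gB, ← two_mul_sum_card_filter_subset, Nat.mul_div_cancel_left _ two_pos]
    · refine Finset.sum_congr rfl fun I hI => ?_
      congr 1
      ext J
      simp only [Finset.mem_filter, and_assoc]
      exact and_congr_right fun _ =>
        ⟨fun h => ⟨h (Finset.mem_filter.1 hI).2, h⟩, fun h => h.2⟩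
    · intro I hI J hJ
      rw [Finset.mem_filter] at hI hJ
      rcases hB.2.1 I hI.1 J hJ.1 with h | h | h | h
      · exact Or.inl h.le
      · have : i ∈ I ∩ J := Finset.mem_inter.2 ⟨hI.2, hJ.2⟩
        rw [h.1] at this
        exact absurd this (Finset.notMem_empty _)
      · exact Or.inl h.1.1
      · exact Or.inr h.1.1
  have heps : epsB D B = ∑ I ∈ B, (B.filter fun J => I ⊆ J).card • eSet D I := by
    have h1 : ∀ I : Finset (ZMod (D + 1)), eSet D I = ∑ i, if i ∈ I then eV D i else 0 := by
      intro I
      rw [eSet, Finset.sum_ite_mem, Finset.univ_inter]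
    simp only [h1, Finset.smul_sum]
    rw [Finset.sum_comm, epsB]
    refine Finset.sum_congr rfl fun i _ => ?_
    rw [← hg i, Nat.cast_smul_eq_nsmul, Finset.sum_smul, Finset.sum_filter]
    refine Finset.sum_congr rfl fun I _ => ?_
    split_ifs <;> simp
  rw [heps]
  exact Submodule.sum_mem _ fun I hI =>
    Submodule.smul_of_tower_mem _ _ (Submodule.subset_span ⟨I, hI, rfl⟩)

lemma leφ_of_subset {B' : Finset (Finset (ZMod (D + 1)))} (hB : phi D B) (hB' : phi D B')
    (h : B ⊆ B') : leφ D B B' := by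
  refine ⟨1, fun s => if s = 0 then B else B', rfl, rfl, fun s _ => ?_, fun s hs => ?_⟩
  · dsimp only
    split_ifs
    exacts [hB, hB']
  · obtain rfl : s = 0 := by omega
    exact Submodule.span_mono (Set.image_mono h) (epsB_mem_spanB hB)

end order

section coefficients

lemma fourierV_sum {ι : Type*} [Fintype ι] (c : ι → ℂ) (g : ι → Vsp D → ℂ) :
    fourierV D (∑ i, c i • g i) = ∑ i, c i • fourierV D (g i) := by
  let _ : Fintype (Vsp D) := Fintype.ofFinite _
  ext y
  simp only [fourierV_apply, Finset.sum_apply, Pi.smul_apply, smul_eq_mul, Finset.mul_sum]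
  rw [Finset.sum_comm]
  refine Finset.sum_congr rfl fun i _ => Finset.sum_congr rfl fun x _ => ?_
  ring

lemma mem_of_sum_smul_mem_span_image {ι K M : Type*} [Fintype ι] [Field K] [AddCommGroup M]
    [Module K M] {v : ι → M} (hv : LinearIndependent K v) {c : ι → K} {s : Set ι}
    (h : ∑ i, c i • v i ∈ Submodule.span K (v '' s)) {i : ι} (hi : c i ≠ 0) : i ∈ s := by
  obtain ⟨l, hl, h⟩ := (Finsupp.mem_span_image_iff_linearCombination K).1 h
  rw [Finsupp.linearCombination_apply, Finsupp.sum_fintype _ _ (by simp)] at h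
  have := hv.eq_coords_of_eq h i
  by_contra his
  apply hi
  rw [← this]
  exact (Finsupp.mem_supported' K l).1 hl i his

variable {n : Finset (Finset (ZMod (D + 1))) → Finset (Finset (ZMod (D + 1))) → ℂ}

open scoped Classical in
lemma fourierV_ind_eq_sum
    (hn : ∀ B, phi D B → fourierV D (ind D ↑(spanB D B)) =
      ∑ᶠ B' ∈ {B' | phi D B'}, n B B' • ind D ↑(spanB D B')) (B : {B // phi D B}) :
    fourierV D (ind D ↑(spanB D B.1)) =
      ∑ B' : {B // phi D B}, n B B' • ind D ↑(spanB D B'.1) := by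
  rw [hn B B.2, ← finsum_set_coe_eq_finsum_mem, finsum_eq_sum_of_fintype]
  rfl

theorem subset_of_coeff_ne_zero (hD : Even D)
    (hn : ∀ B, phi D B → fourierV D (ind D ↑(spanB D B)) =
      ∑ᶠ B' ∈ {B' | phi D B'}, n B B' • ind D ↑(spanB D B'))
    {B B' : Finset (Finset (ZMod (D + 1)))} (hB : phi D B) (hB' : phi D B') (h : n B B' ≠ 0) :
    B ⊆ B' := by
  classical
  have h1 := (isMatching_of_phi hD hB).fourierV_mem_upperSpan hD
  rw [fourierV_ind_eq_sum hn ⟨B, hB⟩, upperSpan] at h1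
  refine mem_of_sum_smul_mem_span_image (linearIndependent_ind_spanB hD)
    (s := {C : {B // phi D B} | B ⊆ C.1}) (c := fun C => n B C) (i := ⟨B', hB'⟩) ?_ h
  have himage : (fun C : {B // phi D B} => ind D ↑(spanB D C.1)) '' {C | B ⊆ C.1} =
      (fun C => ind D ↑(spanB D C)) '' {C | phi D C ∧ B ⊆ C} := by
    ext f
    constructor
    · rintro ⟨C, hC, rfl⟩
      exact ⟨C.1, ⟨C.2, hC⟩, rfl⟩
    · rintro ⟨C, hC, rfl⟩
      exact ⟨⟨C, hC.1⟩, hC.2, rfl⟩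
  rwa [himage]

theorem coeff_self_mul_self (hD : Even D)
    (hn : ∀ B, phi D B → fourierV D (ind D ↑(spanB D B)) =
      ∑ᶠ B' ∈ {B' | phi D B'}, n B B' • ind D ↑(spanB D B'))
    {B : Finset (Finset (ZMod (D + 1)))} (hB : phi D B) : n B B * n B B = 1 := by
  classical
  have h1 := fourierV_fourierV hD (ind D ↑(spanB D B))
  rw [fourierV_ind_eq_sum hn ⟨B, hB⟩, fourierV_sum] at h1
  simp only [fourierV_ind_eq_sum hn, Finset.smul_sum, smul_smul] at h1
  rw [Finset.sum_comm] at h1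
  simp only [← Finset.sum_smul] at h1
  have h2 : ind D ↑(spanB D B) = ∑ C : {B // phi D B},
      (Pi.single ⟨B, hB⟩ 1 : {B // phi D B} → ℂ) C • ind D ↑(spanB D C.1) := by
    simp [Pi.single_apply, ite_smul]
  have h3 := (linearIndependent_ind_spanB hD).eq_coords_of_eq (h1.trans h2) ⟨B, hB⟩
  rw [Pi.single_eq_same, Finset.sum_eq_single ⟨B, hB⟩] at h3
  · exact h3
  · intro C _ hC
    by_contra hne
    apply hC
    exact Subtype.ext ((subset_of_coeff_ne_zero hD hn C.2 hB (right_ne_zero_of_mul hne)).antisymm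
      (subset_of_coeff_ne_zero hD hn hB C.2 (left_ne_zero_of_mul hne)))
  · simp

end coefficients

end ArcMatching

/-- Triangularity of the Fourier transform in the new basis (3.2(a)). -/
theorem fourier_triangular (D : ℕ) (hD : 2 ≤ D) (hDev : Even D)
    (n : Finset (Finset (ZMod (D + 1))) → Finset (Finset (ZMod (D + 1))) → ℂ)
    (hn : ∀ B, phi D B → fourierV D (ind D ↑(spanB D B)) =
      ∑ᶠ B' ∈ {B' | phi D B'}, n B B' • ind D ↑(spanB D B')) :
    (∀ B B', phi D B → phi D B' → n B B' ≠ 0 → B ≠ B' →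
      ltφ D B B' ∧ B.card < B'.card) ∧
    (∀ B, phi D B → n B B = 1 ∨ n B B = -1) := by
  refine ⟨fun B B' hB hB' hne hBB' => ?_, fun B hB => ?_⟩
  · have h := ArcMatching.subset_of_coeff_ne_zero hDev hn hB hB' hne
    exact ⟨⟨ArcMatching.leφ_of_subset hB hB' h, hBB'⟩,
      Finset.card_lt_card (Finset.ssubset_iff_subset_ne.2 ⟨h, hBB'⟩)⟩
  · exact mul_self_eq_one_iff.1 (ArcMatching.coeff_self_mul_self hDev hn hB)
end
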